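/- arXiv:2204.05489 — 3 statements merged into one kernel-verified Lean document; each statement's English description precedes it below -/
import Mathlib

section
/- Let G be a unicyclic graph whose unique cycle is the odd cycle C_{2n+1} = (x_1,…,x_{2n+1}) (n ≥ 1), let I = I(G) be its edge ideal in R, and let 𝔪 be the homogeneous maximal ideal of R generated by the vertices of G. Fix s ≥ n+1. Then there exists an integer γ(s) with 𝔪^{γ(s)}·I^{(s)} ⊆ I^s if and only if every vertex of G lies in the closed neighborhood N[V(C_{2n+1})], i.e., every vertex of G is a vertex of C_{2n+1} or is adjacent to a vertex of C_{2n+1}. -/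
open MvPolynomial

noncomputable section

/-- The edge ideal of a simple graph: `I(G) = ⟨X_u · X_v : {u,v} ∈ E(G)⟩`. -/
def edgeIdeal (𝕜 : Type) [Field 𝕜] {V : Type} (G : SimpleGraph V) :
    Ideal (MvPolynomial V 𝕜) :=
  Ideal.span {p | ∃ u v : V, G.Adj u v ∧ p = X u * X v}

/-- `G` is a unicyclic graph (connected with exactly one cycle, equivalently connected with as
many edges as vertices) whose unique cycle is the odd cycle `C_{2n+1}` on the vertices `x j`. -/
structure IsUnicyclicOddCycle {V : Type} [Fintype V] (G : SimpleGraph V) (n : ℕ)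
    (x : ZMod (2 * n + 1) → V) : Prop where
  connected : G.Connected
  edge_count : G.edgeSet.ncard = Fintype.card V
  inj : Function.Injective x
  adj_iff : ∀ i j : ZMod (2 * n + 1), G.Adj (x i) (x j) ↔ (j = i + 1 ∨ i = j + 1)

/-- `f` is a minimal monomial generator of the monomial ideal `J`: it is a monic monomial
belonging to `J` such that no monic monomial of `J` properly divides it. -/
def IsMinMonomialGen {𝕜 : Type} [Field 𝕜] {V : Type} (J : Ideal (MvPolynomial V 𝕜))
    (f : MvPolynomial V 𝕜) : Prop :=
  (∃ m : V →₀ ℕ, f = monomial m 1) ∧ f ∈ J ∧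
    ∀ g : MvPolynomial V 𝕜, (∃ m : V →₀ ℕ, g = monomial m 1) → g ∈ J → g ∣ f → g = f

def localizationComap {R : Type} [CommRing R] (p : Ideal R) (hp : p.IsPrime) (J : Ideal R) :
    Ideal R :=
  letI := hp
  Ideal.comap (algebraMap R (Localization p.primeCompl))
    (Ideal.map (algebraMap R (Localization p.primeCompl)) J)

/-- The `s`-th symbolic power `I^{(s)} = ⋂_{p ∈ Ass(R/I)} (I^s R_p ∩ R)`. -/
def symbolicPower {R : Type} [CommRing R] (I : Ideal R) (s : ℕ) : Ideal R :=
  sInf {J : Ideal R | ∃ (p : Ideal R) (hp : p.IsPrime),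
    p ∈ associatedPrimes R (R ⧸ I) ∧ J = localizationComap p hp (I ^ s)}

/-- The `s`-th symbolic defect of `I`: the minimal number of generators of the module
`I^{(s)}/I^s`, i.e. the least `m` such that `I^{(s)} = I^s + (f_1, …, f_m)` for some
`f_1, …, f_m ∈ I^{(s)}`. -/
def sdefect {R : Type} [CommRing R] (I : Ideal R) (s : ℕ) : ℕ :=
  sInf {m : ℕ | ∃ S : Finset R, S.card = m ∧ (↑S : Set R) ⊆ (symbolicPower I s : Set R) ∧
    I ^ s ⊔ Ideal.span (↑S : Set R) = symbolicPower I s}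


namespace UAI

/-- An acyclic finite graph with an edge has a leaf. -/
theorem exists_leaf {V : Type} [Fintype V] (H : SimpleGraph V) (hH : H.IsAcyclic)
    {a b : V} (hab : H.Adj a b) : ∃ l u, H.Adj l u ∧ ∀ w, H.Adj l w → w = u := by
  classical
  let P : ℕ → Prop := fun L => ∃ (u v : V) (p : H.Walk u v), p.IsPath ∧ p.length = L
  have hP1 : P 1 := ⟨a, b, hab.toWalk, by simp [hab.ne], rfl⟩
  have hcard : ∀ L, P L → L ≤ Fintype.card V := by
    rintro L ⟨u, v, p, hp, rfl⟩
    exact hp.length_lt.le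
  have hmax := Nat.findGreatest_spec (P := P) (hcard 1 hP1) hP1
  have hge := Nat.le_findGreatest (P := P) (hcard 1 hP1) hP1
  obtain ⟨u, v, p, hp, hL⟩ := hmax
  have hnn : ¬ p.Nil := by
    intro h
    have := SimpleGraph.Walk.length_eq_zero_iff.mpr h
    omega
  refine ⟨u, p.snd, p.adj_snd hnn, ?_⟩
  intro w hw
  by_cases hmem : w ∈ p.support
  · exact hH.eq_snd_of_adj_start hp hw hmem
  · exfalso
    have hq : (SimpleGraph.Walk.cons hw.symm p).IsPath := hp.cons hmem
    have h2 : P (p.length + 1) := ⟨_, _, _, hq, by simp⟩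
    have := Nat.le_findGreatest (P := P) (hcard _ h2) h2
    omega

theorem edge_mem (𝕜 : Type) [Field 𝕜] {V : Type} (G : SimpleGraph V) {u v : V}
    (h : G.Adj u v) : (X u * X v : MvPolynomial V 𝕜) ∈ edgeIdeal 𝕜 G :=
  Ideal.subset_span ⟨u, v, h, rfl⟩

theorem edgeIdeal_mono (𝕜 : Type) [Field 𝕜] {V : Type} {G H : SimpleGraph V} (h : H ≤ G) :
    edgeIdeal 𝕜 H ≤ edgeIdeal 𝕜 G := by
  apply Ideal.span_mono
  rintro p ⟨u, v, huv, rfl⟩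
  exact ⟨u, v, h huv, rfl⟩

/-- Weighted König theorem for forests. -/
theorem konig {V : Type} [Fintype V] (𝕜 : Type) [Field 𝕜] (N : ℕ) :
    ∀ (H : SimpleGraph V), H.IsAcyclic → H.edgeSet.ncard ≤ N → ∀ (r : ℕ) (a : V →₀ ℕ),
      (∀ D : Finset V, (∀ u v, H.Adj u v → u ∈ D ∨ v ∈ D) → r ≤ ∑ v ∈ D, a v) →
      (monomial a (1 : 𝕜)) ∈ edgeIdeal 𝕜 H ^ r := by
  classical
  induction N with
  | zero =>
    intro H hH hc r a hD
    have h0 : H.edgeSet = ∅ := by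
      rwa [Nat.le_zero, Set.ncard_eq_zero] at hc
    have := hD ∅ (by
      intro u v huv
      have : s(u, v) ∈ H.edgeSet := huv
      simp [h0] at this)
    have hr : r = 0 := by simpa using this
    subst hr
    simp
  | succ N ih =>
    intro H hH hc r a hD
    by_cases hE : ∃ p q, H.Adj p q
    swap
    · have := hD ∅ (fun u v huv => (hE ⟨u, v, huv⟩).elim)
      have hr : r = 0 := by simpa using this
      subst hr
      simp
    obtain ⟨p, q, hpq⟩ := hE
    obtain ⟨l, u, hlu, hleaf⟩ := exists_leaf H hH hpq
    have hne : l ≠ u := hlu.ne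
    set H' := H.deleteEdges {s(l, u)} with hH'
    have hle : H' ≤ H := SimpleGraph.deleteEdges_le _
    set μ := min (a l) (a u) with hμ
    have hd : Finsupp.single l μ + Finsupp.single u μ ≤ a := by
      intro v
      simp only [Finsupp.add_apply, Finsupp.single_apply]
      by_cases h1 : l = v
      · subst h1; simp [hne.symm, hμ]
      · by_cases h2 : u = v
        · subst h2; simp [hne, hμ]
        · simp [h1, h2]
    obtain ⟨a', ha'⟩ := exists_add_of_le hd
    have hal : a l = μ + a' l := by
      rw [ha']; simp [Finsupp.single_apply, hne.symm]
    have hau : a u = μ + a' u := by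
      rw [ha']; simp [Finsupp.single_apply, hne]
    have hav : ∀ v, v ≠ l → v ≠ u → a v = a' v := by
      intro v h1 h2
      rw [ha']; simp [Finsupp.single_apply, h1.symm, h2.symm]
    have hcard : H'.edgeSet.ncard ≤ N := by
      have hlt : H'.edgeSet.ncard < H.edgeSet.ncard := by
        apply Set.ncard_lt_ncard
        · refine ⟨SimpleGraph.edgeSet_mono hle, ?_⟩
          intro h
          have h3 : s(l, u) ∈ H'.edgeSet := h hlu
          simp [hH'] at h3
        · exact Set.toFinite _
      omega
    have key := ih H' (hH.anti hle) hcard (r - μ) a' (by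
      intro D' hD'
      set E := (D'.erase l).erase u with hEdef
      have hsum : ∑ v ∈ E, a v = ∑ v ∈ E, a' v := by
        apply Finset.sum_congr rfl
        intro v hv
        simp only [hEdef, Finset.mem_erase] at hv
        exact hav v hv.2.1 hv.1
      have huE : u ∉ E := by simp [hEdef]
      have hlE : l ∉ E := by simp [hEdef]
      have hED : E ⊆ D' := fun v hv => by
        simp only [hEdef, Finset.mem_erase] at hv; exact hv.2.2
      have hcov : ∀ v w, H.Adj v w → (v = l ∧ w = u) ∨ (v = u ∧ w = l) ∨
          (v ≠ l ∧ w ≠ l ∧ (v ∈ D' ∨ w ∈ D')) := by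
        intro v w hvw
        by_cases h1 : v = l
        · subst h1; exact Or.inl ⟨rfl, hleaf _ hvw⟩
        · by_cases h2 : w = l
          · subst h2; exact Or.inr (Or.inl ⟨hleaf _ hvw.symm, rfl⟩)
          · refine Or.inr (Or.inr ⟨h1, h2, hD' v w ?_⟩)
            rw [hH', SimpleGraph.deleteEdges_adj]
            refine ⟨hvw, ?_⟩
            simp [h1, h2]
      by_cases hcase : u ∈ D' ∨ a u ≤ a l
      · have h1 := hD (insert u E) (by
          intro v w hvw
          simp only [hEdef, Finset.mem_insert, Finset.mem_erase]
          rcases hcov v w hvw with ⟨h, h'⟩ | ⟨h, h'⟩ | ⟨h, h', h''⟩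
          · right; left; exact h'
          · left; left; exact h
          · by_cases hv : v = u
            · left; left; exact hv
            · by_cases hw : w = u
              · right; left; exact hw
              · rcases h'' with h'' | h''
                · left; right; exact ⟨hv, h, h''⟩
                · right; right; exact ⟨hw, h', h''⟩)
        rw [Finset.sum_insert huE, hsum] at h1
        by_cases huD : u ∈ D'
        · have h2 : ∑ v ∈ insert u E, a' v ≤ ∑ v ∈ D', a' v :=
            Finset.sum_le_sum_of_subset (Finset.insert_subset huD hED)
          rw [Finset.sum_insert huE] at h2
          omega
        · have h3 : a u ≤ a l := by tauto
          have h2 : ∑ v ∈ E, a' v ≤ ∑ v ∈ D', a' v := Finset.sum_le_sum_of_subset hED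
          omega
      · push Not at hcase
        have h1 := hD (insert l E) (by
          intro v w hvw
          simp only [hEdef, Finset.mem_insert, Finset.mem_erase]
          rcases hcov v w hvw with ⟨h, h'⟩ | ⟨h, h'⟩ | ⟨h, h', h''⟩
          · left; left; exact h
          · right; left; exact h'
          · rcases h'' with h'' | h''
            · left; right; exact ⟨fun e => hcase.1 (e ▸ h''), h, h''⟩
            · right; right; exact ⟨fun e => hcase.1 (e ▸ h''), h', h''⟩)
        rw [Finset.sum_insert hlE, hsum] at h1
        have h2 : ∑ v ∈ E, a' v ≤ ∑ v ∈ D', a' v := Finset.sum_le_sum_of_subset hED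
        omega)
    have hmon : (monomial a (1 : 𝕜)) = (X l * X u) ^ μ * monomial a' 1 := by
      rw [mul_pow, X_pow_eq_monomial, X_pow_eq_monomial, monomial_mul, monomial_mul, ha']
      simp
    rw [hmon]
    have h1 := Ideal.mul_mem_mul (Ideal.pow_mem_pow (edge_mem 𝕜 H hlu) μ)
      (Ideal.pow_right_mono (edgeIdeal_mono 𝕜 hle) (r - μ) key)
    rw [← pow_add] at h1
    exact Ideal.pow_le_pow_right (by omega) h1

/-- Deleting a cycle edge yields an acyclic graph. -/
theorem delete_acyclic {V : Type} [Fintype V] (G : SimpleGraph V) (n : ℕ) (hn : 1 ≤ n)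
    (x : ZMod (2 * n + 1) → V) (hx : IsUnicyclicOddCycle G n x) (j : ZMod (2 * n + 1)) :
    (G.deleteEdges {s(x j, x (j + 1))}).IsAcyclic := by
  classical
  have hadj : G.Adj (x j) (x (j + 1)) := (hx.adj_iff _ _).2 (Or.inl rfl)
  have h2 : (2 : ZMod (2 * n + 1)) ≠ 0 := by
    intro h
    have h' : ((2 : ℕ) : ZMod (2 * n + 1)) = 0 := by exact_mod_cast h
    rw [ZMod.natCast_eq_zero_iff] at h'
    have := Nat.le_of_dvd (by norm_num) h'
    omega
  have hreach : ∀ k : ℕ, k ≤ 2 * n →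
      (G.deleteEdges {s(x j, x (j + 1))}).Reachable (x (j + 1)) (x (j + 1 + k)) := by
    intro k
    induction k with
    | zero => intro _; simp
    | succ k ih =>
      intro hk
      refine (ih (by omega)).trans (SimpleGraph.Adj.reachable ?_)
      rw [SimpleGraph.deleteEdges_adj]
      refine ⟨(hx.adj_iff _ _).2 (Or.inl (by push_cast; ring)), ?_⟩
      intro h
      have hk1 : ((k + 1 : ℕ) : ZMod (2 * n + 1)) ≠ 0 := by
        intro h'
        rw [ZMod.natCast_eq_zero_iff] at h'
        have := Nat.le_of_dvd (by omega) h'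
        omega
      rw [Set.mem_singleton_iff, Sym2.eq_iff] at h
      push_cast at h hk1
      rcases h with ⟨h, h'⟩ | ⟨h, h'⟩
      · have := hx.inj h
        exact hk1 (by linear_combination this)
      · have e1 := hx.inj h
        have e2 := hx.inj h'
        exact h2 (by linear_combination e2 - e1)
  have hnb : ¬ G.IsBridge s(x j, x (j + 1)) := by
    rw [SimpleGraph.isBridge_iff, not_not]
    have := hreach (2 * n) le_rfl
    have e : j + 1 + ((2 * n : ℕ) : ZMod (2 * n + 1)) = j := by
      have : ((2 * n + 1 : ℕ) : ZMod (2 * n + 1)) = 0 := ZMod.natCast_self _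
      push_cast at this ⊢
      linear_combination this
    rw [e] at this
    exact this.symm
  have hconn := hx.connected.connected_delete_edge_of_not_isBridge hnb
  have : (G.deleteEdges {s(x j, x (j + 1))}).IsTree := by
    rw [SimpleGraph.isTree_iff_connected_and_card]
    refine ⟨hconn, ?_⟩
    rw [SimpleGraph.edgeSet_deleteEdges, Nat.card_coe_set_eq, Set.ncard_sdiff_singleton_add_one,
      hx.edge_count, Nat.card_eq_fintype_card]
    · exact hadj
  exact this.isAcyclic

/-- Divisibility test: products of edges have small multiplicity. -/
theorem konig_star {V : Type} [Fintype V] (𝕜 : Type) [Field 𝕜] (G : SimpleGraph V)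
    (n : ℕ) (hn : 1 ≤ n)
    (x : ZMod (2 * n + 1) → V) (hx : IsUnicyclicOddCycle G n x) (s : ℕ) (w : V)
    (j : ZMod (2 * n + 1)) (hw : G.Adj w (x j)) (a : V →₀ ℕ)
    (ha : ∀ D : Finset V, (∀ u v, G.Adj u v → u ∈ D ∨ v ∈ D) → s ≤ ∑ v ∈ D, a v) :
    (X w ^ s * monomial a 1 : MvPolynomial V 𝕜) ∈ edgeIdeal 𝕜 G ^ s := by
  classical
  let H : SimpleGraph V :=
    { Adj := fun u v => G.Adj u v ∧ (u = w ∨ v = w ∨ (¬ G.Adj w u ∧ ¬ G.Adj w v))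
      symm := ⟨fun u v h => ⟨h.1.symm, by tauto⟩⟩
      loopless := ⟨fun u h => h.1.ne rfl⟩ }
  have hHG : H ≤ G := fun u v h => h.1
  have hac : H.IsAcyclic := by
    by_cases h1 : x (j + 1) = w
    · refine (delete_acyclic G n hn x hx (j - 1)).anti ?_
      intro u v h
      rw [SimpleGraph.deleteEdges_adj]
      refine ⟨h.1, ?_⟩
      intro h'
      rw [sub_add_cancel] at h'
      have h3 : x (j - 1) ≠ w := by
        rw [← h1]
        intro e
        have e := hx.inj e
        have h' : ((2 : ℕ) : ZMod (2 * n + 1)) = 0 := by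
          push_cast; linear_combination -e
        rw [ZMod.natCast_eq_zero_iff] at h'
        have := Nat.le_of_dvd (by norm_num) h'
        omega
      rw [Set.mem_singleton_iff, Sym2.eq_iff] at h'
      have hne := hw.ne
      obtain ⟨hG, h⟩ := h
      rcases h' with ⟨rfl, rfl⟩ | ⟨rfl, rfl⟩ <;> rcases h with h | h | h <;>
        first | exact h3 h | exact hne h.symm | exact h.1 hw | exact h.2 hw
    · refine (delete_acyclic G n hn x hx j).anti ?_
      intro u v h
      rw [SimpleGraph.deleteEdges_adj]
      refine ⟨h.1, ?_⟩
      intro h'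
      rw [Set.mem_singleton_iff, Sym2.eq_iff] at h'
      have hne := hw.ne
      obtain ⟨hG, h⟩ := h
      rcases h' with ⟨rfl, rfl⟩ | ⟨rfl, rfl⟩ <;> rcases h with h | h | h <;>
        first | exact h1 h | exact hne h.symm | exact h.1 hw | exact h.2 hw
  have := konig 𝕜 _ H hac le_rfl s (Finsupp.single w s + a) (by
    intro D hD
    by_cases hwD : w ∈ D
    · calc s ≤ (Finsupp.single w s + a) w := by simp
        _ ≤ _ := Finset.single_le_sum (f := fun v => (Finsupp.single w s + a) v)
            (fun _ _ => Nat.zero_le _) hwD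
    · have hN : ∀ v, G.Adj w v → v ∈ D := by
        intro v hv
        have := hD w v ⟨hv, Or.inl rfl⟩
        tauto
      have h1 := ha D (by
        intro u v huv
        by_cases hu : G.Adj w u
        · exact Or.inl (hN u hu)
        · by_cases hv : G.Adj w v
          · exact Or.inr (hN v hv)
          · exact hD u v ⟨huv, Or.inr (Or.inr ⟨hu, hv⟩)⟩)
      refine h1.trans (Finset.sum_le_sum ?_)
      intro v _
      simp)
  rw [X_pow_eq_monomial, monomial_mul, one_mul]
  exact Ideal.pow_right_mono (edgeIdeal_mono 𝕜 hHG) s this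

/-- The grading homomorphism with respect to a set of vertices. -/
def phi (𝕜 : Type) [Field 𝕜] {V : Type} (D : Finset V) :
    MvPolynomial V 𝕜 →+* Polynomial (MvPolynomial V 𝕜) :=
  open Classical in
  eval₂Hom (Polynomial.C.comp C)
    (fun v => Polynomial.X ^ (if v ∈ D then 1 else 0) * Polynomial.C (X v))

theorem phi_X (𝕜 : Type) [Field 𝕜] {V : Type} (D : Finset V) [DecidableEq V] (v : V) :
    phi 𝕜 D (X v) = Polynomial.X ^ (if v ∈ D then 1 else 0) * Polynomial.C (X v) := by
  simp [phi]

theorem phi_monomial (𝕜 : Type) [Field 𝕜] {V : Type} (D : Finset V) (m : V →₀ ℕ) (c : 𝕜) :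
    phi 𝕜 D (monomial m c) = Polynomial.X ^ (∑ v ∈ D, m v) * Polynomial.C (monomial m c) := by
  classical
  induction m using Finsupp.induction generalizing c with
  | zero => simp [phi]
  | single_add a b f ha hb ih =>
    have h1 : monomial (Finsupp.single a b + f) c = (X a ^ b * monomial f c : MvPolynomial V 𝕜) := by
      rw [X_pow_eq_monomial, monomial_mul, one_mul]
    rw [h1, map_mul, map_pow, ih, phi_X, Polynomial.C_mul, Polynomial.C_pow, mul_pow, ← pow_mul]
    have h2 : ∑ v ∈ D, (Finsupp.single a b + f) v
        = (if a ∈ D then 1 else 0) * b + ∑ v ∈ D, f v := by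
      simp [Finset.sum_add_distrib, Finsupp.single_apply, Finset.sum_ite_eq]
    rw [h2, pow_add]
    ring

theorem phi_coeff (𝕜 : Type) [Field 𝕜] {V : Type} (D : Finset V) (p : MvPolynomial V 𝕜)
    (j : ℕ) (m : V →₀ ℕ) :
    coeff m ((phi 𝕜 D p).coeff j) = if ∑ v ∈ D, m v = j then coeff m p else 0 := by
  classical
  induction p using MvPolynomial.induction_on' with
  | monomial u a =>
    rw [phi_monomial, Polynomial.coeff_X_pow_mul', Polynomial.coeff_C, coeff_monomial]
    by_cases hu : u = m
    · subst hu
      by_cases h1 : ∑ v ∈ D, u v = j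
      · subst h1; simp
      · by_cases h2 : ∑ v ∈ D, u v ≤ j
        · have : j - ∑ v ∈ D, u v ≠ 0 := by omega
          simp [h1, h2, this]
        · simp [h1, h2]
    · simp only [hu, if_false]
      split_ifs <;> simp [hu]
  | add p q hp hq =>
    simp only [map_add, Polynomial.coeff_add, coeff_add, hp, hq]
    split_ifs <;> simp

theorem phi_dvd_iff (𝕜 : Type) [Field 𝕜] {V : Type} (D : Finset V) (p : MvPolynomial V 𝕜)
    (s : ℕ) : Polynomial.X ^ s ∣ phi 𝕜 D p ↔ ∀ m ∈ p.support, s ≤ ∑ v ∈ D, m v := by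
  rw [Polynomial.X_pow_dvd_iff]
  constructor
  · intro h m hm
    by_contra hlt
    push Not at hlt
    have h1 := phi_coeff 𝕜 D p (∑ v ∈ D, m v) m
    rw [h _ hlt] at h1
    simp at h1
    exact (mem_support_iff.mp hm) h1.symm
  · intro h d hd
    ext m
    rw [phi_coeff, coeff_zero]
    split_ifs with h1
    · by_contra h2
      have := h m (mem_support_iff.mpr h2)
      omega
    · rfl

theorem phi_pow_dvd (𝕜 : Type) [Field 𝕜] {V : Type} (G : SimpleGraph V) (D : Finset V)
    (hD : ∀ u v, G.Adj u v → u ∈ D ∨ v ∈ D) (s : ℕ) (p : MvPolynomial V 𝕜)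
    (hp : p ∈ edgeIdeal 𝕜 G ^ s) : Polynomial.X ^ s ∣ phi 𝕜 D p := by
  classical
  have h1 : edgeIdeal 𝕜 G ≤ Ideal.comap (phi 𝕜 D) (Ideal.span {Polynomial.X}) := by
    refine Ideal.span_le.2 ?_
    rintro _ ⟨u, v, huv, rfl⟩
    simp only [SetLike.mem_coe, Ideal.mem_comap, Ideal.mem_span_singleton, map_mul, phi_X]
    rcases hD u v huv with h | h
    · exact Dvd.dvd.mul_right (by simp [h]) _
    · exact Dvd.dvd.mul_left (by simp [h]) _
  have h2 := (Ideal.pow_right_mono h1 s).trans (Ideal.le_comap_pow _ s) hp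
  rwa [Ideal.mem_comap, Ideal.span_singleton_pow, Ideal.mem_span_singleton] at h2

theorem mem_edgeIdeal (𝕜 : Type) [Field 𝕜] {V : Type} (G : SimpleGraph V)
    (p : MvPolynomial V 𝕜) : p ∈ edgeIdeal 𝕜 G ↔
      ∀ m ∈ p.support, ∃ u v, G.Adj u v ∧ m u ≠ 0 ∧ m v ≠ 0 := by
  classical
  have h : {p : MvPolynomial V 𝕜 | ∃ u v : V, G.Adj u v ∧ p = X u * X v} =
      (fun s => monomial s (1 : 𝕜)) ''
        {m | ∃ u v : V, G.Adj u v ∧ m = Finsupp.single u 1 + Finsupp.single v 1} := by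
    ext p
    constructor
    · rintro ⟨u, v, huv, rfl⟩
      exact ⟨_, ⟨u, v, huv, rfl⟩, by simp [X, monomial_mul]⟩
    · rintro ⟨_, ⟨u, v, huv, rfl⟩, rfl⟩
      exact ⟨u, v, huv, by simp [X, monomial_mul]⟩
  rw [edgeIdeal, h, mem_ideal_span_monomial_image]
  refine forall₂_congr fun m hm => ?_
  constructor
  · rintro ⟨_, ⟨u, v, huv, rfl⟩, hle⟩
    refine ⟨u, v, huv, ?_, ?_⟩
    · have := hle u
      simp at this; omega
    · have := hle v
      simp at this; omega
  · rintro ⟨u, v, huv, h1, h2⟩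
    refine ⟨_, ⟨u, v, huv, rfl⟩, ?_⟩
    intro w
    have := huv.ne
    simp only [Finsupp.add_apply, Finsupp.single_apply]
    split_ifs with h3 h4 h4
    · exact absurd (h3.trans h4.symm) this
    · subst h3; omega
    · subst h4; omega
    · omega

theorem mem_symbolicPower {R : Type} [CommRing R] (I : Ideal R) (s : ℕ) (f : R) :
    f ∈ symbolicPower I s ↔ ∀ p : Ideal R, p ∈ associatedPrimes R (R ⧸ I) →
      ∃ u, u ∉ p ∧ u * f ∈ I ^ s := by
  have key : ∀ (p : Ideal R) (hp : p.IsPrime), f ∈ localizationComap p hp (I ^ s) ↔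
      ∃ u, u ∉ p ∧ u * f ∈ I ^ s := by
    intro p hp
    unfold localizationComap
    rw [Ideal.mem_comap, IsLocalization.algebraMap_mem_map_algebraMap_iff p.primeCompl]
    rfl
  rw [symbolicPower, Submodule.mem_sInf]
  constructor
  · intro h p hp
    exact (key p hp.1).1 (h _ ⟨p, hp.1, hp, rfl⟩)
  · rintro h _ ⟨p, hp, hass, rfl⟩
    exact (key p hp).2 (h p hass)

/-- minimal covers give associated primes -/
theorem cover_of_mem {V : Type} [Fintype V] (𝕜 : Type) [Field 𝕜] (G : SimpleGraph V)
    (s : ℕ) (f : MvPolynomial V 𝕜) (hf : f ∈ symbolicPower (edgeIdeal 𝕜 G) s)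
    (D : Finset V) (hD : ∀ u v, G.Adj u v → u ∈ D ∨ v ∈ D)
    (m : V →₀ ℕ) (hm : m ∈ f.support) : s ≤ ∑ v ∈ D, m v := by
  classical
  obtain ⟨D', hD'D, hmin⟩ := exists_minimal_le_of_wellFoundedLT
    (fun D : Finset V => ∀ u v, G.Adj u v → u ∈ D ∨ v ∈ D) D hD
  refine le_trans ?_ (Finset.sum_le_sum_of_subset hD'D)
  clear hD hD'D D
  have hc := hmin.1
  have hnb : ∀ v ∈ D', ∃ w, G.Adj v w ∧ w ∉ D' := by
    intro v hv
    by_contra hcon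
    push Not at hcon
    have h1 : D' ≤ D'.erase v := hmin.2 (by
      intro a b hab
      simp only [Finset.mem_erase]
      by_cases h1 : a = v
      · subst h1
        exact Or.inr ⟨hab.ne.symm, hcon b hab⟩
      · by_cases h2 : b = v
        · subst h2
          exact Or.inl ⟨hab.ne, hcon a hab.symm⟩
        · rcases hc a b hab with h | h
          · exact Or.inl ⟨h1, h⟩
          · exact Or.inr ⟨h2, h⟩) (Finset.erase_subset _ _)
    exact Finset.notMem_erase v D' (h1 hv)
  set P : Ideal (MvPolynomial V 𝕜) := Ideal.comap (phi 𝕜 D') (Ideal.span {Polynomial.X}) with hP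
  have hXp : Prime (Polynomial.X : Polynomial (MvPolynomial V 𝕜)) := Polynomial.prime_X
  have hPp : P.IsPrime := by
    have : (Ideal.span {(Polynomial.X : Polynomial (MvPolynomial V 𝕜))}).IsPrime :=
      (Ideal.span_singleton_prime hXp.ne_zero).2 hXp
    exact Ideal.comap_isPrime _ _
  have hmemP : ∀ h, h ∈ P ↔ Polynomial.X ∣ phi 𝕜 D' h := by
    intro h
    rw [hP, Ideal.mem_comap, Ideal.mem_span_singleton]
  set g : MvPolynomial V 𝕜 := ∏ v ∈ D'ᶜ, X v with hg
  have hgP : g ∉ P := by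
    intro h
    rw [hg, hPp.prod_mem_iff] at h
    obtain ⟨v, hv, h⟩ := h
    rw [hmemP, ← pow_one Polynomial.X, phi_dvd_iff] at h
    have := h (Finsupp.single v 1) (by simp)
    rw [Finset.sum_eq_zero] at this
    · omega
    · intro w hw
      rw [Finset.mem_compl] at hv
      have : v ≠ w := fun e => hv (e ▸ hw)
      simp [this]
  have hIP : edgeIdeal 𝕜 G ≤ P := by
    intro p hp
    rw [hmemP]
    simpa using phi_pow_dvd 𝕜 G D' hc 1 p (by simpa using hp)
  have hPg : ∀ h, h ∈ P ↔ h * g ∈ edgeIdeal 𝕜 G := by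
    intro h
    constructor
    · intro hh
      have h1 : h ∈ Ideal.span (X '' (D' : Set V)) := by
        rw [mem_ideal_span_X_image]
        intro m hm
        rw [hmemP, ← pow_one Polynomial.X, phi_dvd_iff] at hh
        have := hh m hm
        by_contra hcon
        push Not at hcon
        rw [Finset.sum_eq_zero (fun v hv => hcon v hv)] at this
        omega
      have h2 : Ideal.span (X '' (D' : Set V)) ≤
          Submodule.comap (LinearMap.mulRight (MvPolynomial V 𝕜) g) (edgeIdeal 𝕜 G) := by
        refine Ideal.span_le.2 ?_
        rintro _ ⟨v, hv, rfl⟩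
        obtain ⟨w, hvw, hw⟩ := hnb v hv
        change X v * g ∈ edgeIdeal 𝕜 G
        rw [hg, ← Finset.mul_prod_erase _ _ (Finset.mem_compl.2 hw), ← mul_assoc]
        exact Ideal.mul_mem_right _ _ (edge_mem 𝕜 G hvw)
      exact h2 h1
    · intro hh
      exact (hPp.mem_or_mem (hIP hh)).resolve_right hgP
  have hass : P ∈ associatedPrimes (MvPolynomial V 𝕜) (MvPolynomial V 𝕜 ⧸ edgeIdeal 𝕜 G) := by
    rw [AssociatedPrimes.mem_iff, isAssociatedPrime_iff]
    refine ⟨hPp, Ideal.Quotient.mk _ g, ?_⟩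
    ext h
    rw [hPg, Submodule.mem_colon_singleton, Submodule.mem_bot, ← Ideal.Quotient.eq_zero_iff_mem,
      map_mul]
    rfl
  obtain ⟨u, hu, huf⟩ := (mem_symbolicPower _ _ _).1 hf P hass
  rw [hmemP] at hu
  have h3 := phi_pow_dvd 𝕜 G D' hc s _ huf
  rw [map_mul] at h3
  exact (phi_dvd_iff 𝕜 D' f s).1 (hXp.pow_dvd_of_dvd_mul_left s hu h3) m hm

theorem backward {V : Type} [Fintype V] (𝕜 : Type) [Field 𝕜]
    (G : SimpleGraph V) (n : ℕ) (hn : 1 ≤ n)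
    (x : ZMod (2 * n + 1) → V) (hx : IsUnicyclicOddCycle G n x) (s : ℕ)
    (h : ∀ v : V, ∃ j : ZMod (2 * n + 1), G.Adj v (x j)) :
    ∃ γ : ℕ, (Ideal.span (Set.range X) : Ideal (MvPolynomial V 𝕜)) ^ γ *
      symbolicPower (edgeIdeal 𝕜 G) s ≤ (edgeIdeal 𝕜 G) ^ s := by
  have h1 : (Ideal.span (Set.range X) : Ideal (MvPolynomial V 𝕜)) ≤
      ((edgeIdeal 𝕜 G ^ s).colon (symbolicPower (edgeIdeal 𝕜 G) s : Set _)).radical := by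
    refine Ideal.span_le.2 ?_
    rintro _ ⟨w, rfl⟩
    refine ⟨s, ?_⟩
    rw [Submodule.mem_colon]
    intro f hf
    obtain ⟨j, hj⟩ := h w
    rw [smul_eq_mul, f.as_sum, Finset.mul_sum]
    refine Ideal.sum_mem _ fun m hm => ?_
    have := konig_star 𝕜 G n hn x hx s w j hj m
      (fun D hD => cover_of_mem 𝕜 G s f hf D hD m hm)
    have e : (monomial m (coeff m f)) = monomial m (1 : 𝕜) * C (coeff m f) := by
      rw [mul_comm, C_mul_monomial, mul_one]
    rw [e, ← mul_assoc]
    exact Ideal.mul_mem_right _ _ this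
  obtain ⟨k, hk⟩ := Ideal.exists_pow_le_of_le_radical_of_fg h1
    (Submodule.fg_span (Set.finite_range _))
  refine ⟨k, ?_⟩
  rw [Ideal.mul_le]
  intro r hr f hf
  exact Submodule.mem_colon.1 (hk hr) f hf

/-- A vertex next to the cycle times the cycle product -/
theorem cycle_prod_mem {V : Type} (𝕜 : Type) [Field 𝕜]
    (G : SimpleGraph V) (n : ℕ) (x : ZMod (2 * n + 1) → V)
    (hx : ∀ i, G.Adj (x i) (x (i + 1))) (i : ZMod (2 * n + 1)) (w : V) (hw : G.Adj w (x i)) :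
    (X w * ∏ j : ZMod (2 * n + 1), X (x j) : MvPolynomial V 𝕜) ∈ edgeIdeal 𝕜 G ^ (n + 1) := by
  have h1 : (∏ j : ZMod (2 * n + 1), X (x j) : MvPolynomial V 𝕜) =
      ∏ k ∈ Finset.range (2 * n + 1), X (x (i + (k : ZMod (2 * n + 1)))) := by
    rw [← Equiv.prod_comp (Equiv.addLeft i)]
    refine Finset.prod_bij' (fun a _ => a.val) (fun k _ => (k : ZMod (2 * n + 1))) ?_ ?_ ?_ ?_ ?_
    · intro a _; exact Finset.mem_range.2 (ZMod.val_lt a)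
    · intro k _; exact Finset.mem_univ _
    · intro a _; simp
    · intro k hk; exact ZMod.val_natCast_of_lt (Finset.mem_range.1 hk)
    · intro a _; simp
  rw [h1]
  have h2 : ∀ m : ℕ, (X w * ∏ k ∈ Finset.range (2 * m + 1), X (x (i + (k : ZMod (2 * n + 1)))) :
      MvPolynomial V 𝕜) ∈ edgeIdeal 𝕜 G ^ (m + 1) := by
    intro m
    induction m with
    | zero => simpa using edge_mem 𝕜 G hw
    | succ m ih =>
      rw [show 2 * (m + 1) + 1 = 2 * m + 1 + 1 + 1 by ring, Finset.prod_range_succ,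
        Finset.prod_range_succ, mul_assoc, ← mul_assoc, pow_succ]
      refine Ideal.mul_mem_mul ih (edge_mem 𝕜 G ?_)
      have := hx (i + ((2 * m + 1 : ℕ) : ZMod (2 * n + 1)))
      convert this using 2
      push_cast; ring
  exact h2 n

theorem assoc_not_mem {V : Type} [Fintype V] (𝕜 : Type) [Field 𝕜] (G : SimpleGraph V)
    (p : Ideal (MvPolynomial V 𝕜))
    (hp : p ∈ associatedPrimes (MvPolynomial V 𝕜) (MvPolynomial V 𝕜 ⧸ edgeIdeal 𝕜 G)) (v : V) :
    ∃ w, (w = v ∨ G.Adj w v) ∧ X w ∉ p := by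
  classical
  rw [AssociatedPrimes.mem_iff, isAssociatedPrime_iff] at hp
  obtain ⟨hpp, q, hq⟩ := hp
  obtain ⟨g, rfl⟩ := Ideal.Quotient.mk_surjective q
  have hmem : ∀ h, h ∈ p ↔ h * g ∈ edgeIdeal 𝕜 G := by
    intro h
    rw [hq, Submodule.mem_colon_singleton, Submodule.mem_bot, ← Ideal.Quotient.eq_zero_iff_mem,
      map_mul]
    rfl
  by_contra hcon
  push Not at hcon
  have hX : ∀ w, X w ∈ p → ∀ m ∈ g.support, ∃ a b, G.Adj a b ∧
      (Finsupp.single w 1 + m : V →₀ ℕ) a ≠ 0 ∧ (Finsupp.single w 1 + m : V →₀ ℕ) b ≠ 0 := by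
    intro w hw m hm
    rw [hmem, mem_edgeIdeal] at hw
    refine hw _ ?_
    rw [mem_support_iff, coeff_X_mul]
    exact mem_support_iff.1 hm
  apply hpp.ne_top
  rw [Ideal.eq_top_iff_one, hmem, one_mul, mem_edgeIdeal]
  intro m hm
  -- squarefree argument
  have hsq : ∀ w, X w ∈ p → m w ≠ 0 → ∃ a b, G.Adj a b ∧ m a ≠ 0 ∧ m b ≠ 0 := by
    intro w hw hmw
    obtain ⟨a, b, hab, h1, h2⟩ := hX w hw m hm
    refine ⟨a, b, hab, ?_, ?_⟩
    · by_cases h : w = a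
      · subst h; exact hmw
      · simpa [Finsupp.single_apply, h] using h1
    · by_cases h : w = b
      · subst h; exact hmw
      · simpa [Finsupp.single_apply, h] using h2
  obtain ⟨a, b, hab, h1, h2⟩ := hX v (hcon v (Or.inl rfl)) m hm
  by_cases hva : v = a
  · subst hva
    have : m b ≠ 0 := by simpa [Finsupp.single_apply, hab.ne] using h2
    exact hsq b (hcon b (Or.inr hab.symm)) this
  · have ha : m a ≠ 0 := by simpa [Finsupp.single_apply, hva] using h1
    by_cases hvb : v = b
    · subst hvb
      exact hsq a (hcon a (Or.inr hab)) ha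
    · exact ⟨a, b, hab, ha, by simpa [Finsupp.single_apply, hvb] using h2⟩

theorem forward {V : Type} [Fintype V] (𝕜 : Type) [Field 𝕜]
    (G : SimpleGraph V) (n : ℕ)
    (x : ZMod (2 * n + 1) → V) (hx : ∀ i, G.Adj (x i) (x (i + 1)))
    (s : ℕ) (hs : n + 1 ≤ s) (γ : ℕ)
    (h : (Ideal.span (Set.range X) : Ideal (MvPolynomial V 𝕜)) ^ γ *
      symbolicPower (edgeIdeal 𝕜 G) s ≤ (edgeIdeal 𝕜 G) ^ s) (v : V)
    (hv1 : ∀ j, v ≠ x j) (hv2 : ∀ j, ¬ G.Adj v (x j)) : False := by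
  classical
  obtain ⟨t, rfl⟩ := Nat.exists_eq_add_of_le hs
  set f : MvPolynomial V 𝕜 := (∏ j : ZMod (2 * n + 1), X (x j)) * (X (x 0) * X (x (0 + 1))) ^ t
    with hf
  have hfs : f ∈ symbolicPower (edgeIdeal 𝕜 G) (n + 1 + t) := by
    rw [mem_symbolicPower]
    intro p hp
    obtain ⟨w, hw, hwp⟩ := assoc_not_mem 𝕜 G p hp (x 0)
    refine ⟨X w, hwp, ?_⟩
    have hi : ∃ i, G.Adj w (x i) := by
      rcases hw with rfl | hw
      · exact ⟨_, hx 0⟩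
      · exact ⟨_, hw⟩
    obtain ⟨i, hi⟩ := hi
    rw [hf, ← mul_assoc, pow_add]
    exact Ideal.mul_mem_mul (cycle_prod_mem 𝕜 G n x hx i w hi)
      (Ideal.pow_mem_pow (edge_mem 𝕜 G (hx 0)) t)
  have hmem := h (Ideal.mul_mem_mul
    (Ideal.pow_mem_pow (Ideal.subset_span (Set.mem_range_self v)) γ) hfs)
  let ψ : MvPolynomial V 𝕜 →+* Polynomial 𝕜 := eval₂Hom Polynomial.C
    (fun u => if u = v then 1 else if ∃ j, u = x j then Polynomial.X else 0)
  have hψv : ψ (X v) = 1 := by simp [ψ]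
  have hψx : ∀ j, ψ (X (x j)) = Polynomial.X := by
    intro j
    simp [ψ, (hv1 j).symm]
  have hψo : ∀ u, u ≠ v → (∀ j, u ≠ x j) → ψ (X u) = 0 := by
    intro u h1 h2
    simp [ψ, h1, h2]
  have h1 : edgeIdeal 𝕜 G ≤ Ideal.comap ψ (Ideal.span {Polynomial.X ^ 2}) := by
    refine Ideal.span_le.2 ?_
    rintro _ ⟨a, b, hab, rfl⟩
    simp only [SetLike.mem_coe, Ideal.mem_comap, Ideal.mem_span_singleton, map_mul]
    by_cases ha : a = v
    · subst ha
      rw [hψo b hab.ne.symm (fun j e => hv2 j (e ▸ hab))]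
      simp
    by_cases hb : b = v
    · subst hb
      rw [hψo a hab.ne (fun j e => hv2 j (e ▸ hab.symm))]
      simp
    by_cases ha2 : ∃ j, a = x j
    · by_cases hb2 : ∃ j, b = x j
      · obtain ⟨i, rfl⟩ := ha2
        obtain ⟨j, rfl⟩ := hb2
        rw [hψx, hψx, sq]
      · push Not at hb2
        rw [hψo b hb hb2]; simp
    · push Not at ha2
      rw [hψo a ha ha2]; simp
  have h2 := (Ideal.pow_right_mono h1 (n + 1 + t)).trans (Ideal.le_comap_pow _ _) hmem
  rw [Ideal.mem_comap, Ideal.span_singleton_pow, Ideal.mem_span_singleton] at h2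
  simp only [hf, map_mul, map_pow, map_prod, hψv, hψx, one_pow, one_mul, Finset.prod_const,
    Finset.card_univ, ZMod.card] at h2
  rw [← pow_two, ← pow_mul, ← pow_mul, ← pow_add] at h2
  have := (pow_dvd_pow_iff Polynomial.X_ne_zero Polynomial.not_isUnit_X).1 h2
  omega

end UAI

/-- for the edge ideal `I` of a unicyclic graph `G` with unique odd cycle
`C_{2n+1}` and `s ≥ n+1`, some power of the homogeneous maximal ideal `𝔪 = (X_v : v ∈ V(G))`
multiplies `I^{(s)}` into `I^s` if and only if every vertex of `G` lies in the closed
neighborhood `N[V(C_{2n+1})]`. -/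
theorem unicyclic_annihilator_iff {V : Type} [Fintype V] (𝕜 : Type) [Field 𝕜]
    (G : SimpleGraph V) (n : ℕ) (hn : 1 ≤ n)
    (x : ZMod (2 * n + 1) → V) (hx : IsUnicyclicOddCycle G n x)
    (𝔪 : Ideal (MvPolynomial V 𝕜)) (h𝔪 : 𝔪 = Ideal.span (Set.range X))
    (s : ℕ) (hs : n + 1 ≤ s) :
    (∃ γ : ℕ, 𝔪 ^ γ * symbolicPower (edgeIdeal 𝕜 G) s ≤ (edgeIdeal 𝕜 G) ^ s) ↔
      ∀ v : V, (∃ j : ZMod (2 * n + 1), v = x j) ∨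
        ∃ j : ZMod (2 * n + 1), G.Adj v (x j) := by
  subst h𝔪
  have hadj : ∀ i, G.Adj (x i) (x (i + 1)) := fun i => (hx.adj_iff _ _).2 (Or.inl rfl)
  constructor
  · rintro ⟨γ, hγ⟩ v
    by_contra hcon
    push Not at hcon
    exact UAI.forward 𝕜 G n x hadj s hs γ hγ v hcon.1 hcon.2
  · intro h
    refine UAI.backward 𝕜 G n hn x hx s fun v => ?_
    rcases h v with ⟨j, rfl⟩ | h
    · exact ⟨_, hadj j⟩
    · exact h

end
end

section
/- Let G be a unicyclic graph whose unique cycle is the odd cycle C_{2n+1} = (x_1,…,x_{2n+1}) (n ≥ 1) such that every vertex of G lies in the closed neighborhood N[V(C_{2n+1})]. Let I = I(G) be its edge ideal in R and 𝔪 the homogeneous maximal ideal generated by the vertices. Write s = k(n+1) + r with k ∈ ℤ and 0 ≤ r ≤ n, and assume s ≥ n+1. Then 𝔪^k·I^{(s)} ⊆ I^s while 𝔪^{k−1}·I^{(s)} ⊄ I^s; that is, k is the least integer γ with 𝔪^γ·I^{(s)} ⊆ I^s. -/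
open MvPolynomial

noncomputable section

theorem path_lemma (N : ℕ) : ∀ (b : ℕ → ℕ) (s : ℕ),
    (∀ (D : ℕ → Prop) [DecidablePred D], (∀ i < N, D i ∨ D (i+1)) → s ≤ ∑ i ∈ Finset.range (N+1), if D i then b i else 0) →
    ∃ y : ℕ → ℕ, y 0 = 0 ∧ y (N+1) = 0 ∧ (∀ i ≤ N, y i + y (i+1) ≤ b i) ∧
      s ≤ ∑ i ∈ Finset.range (N+1), y i := by
  induction N with
  | zero =>
    intro b s h
    have := h (fun _ => False) (by simp)
    refine ⟨fun _ => 0, rfl, rfl, by simp, by simpa using this⟩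
  | succ N ih =>
    intro b s h
    set w := min (b (N+1)) (b N) with hw
    set b' : ℕ → ℕ := fun i => if i = N then b N - w else b i with hb'
    have key : ∀ (D : ℕ → Prop) [DecidablePred D], D N → (∀ i < N, D i ∨ D (i+1)) →
        s - w ≤ ∑ i ∈ Finset.range (N+1), if D i then b' i else 0 := by
      intro D _ hN hD
      have := h (fun i => D i ∧ i ≠ N + 1) (by
        intro i hi
        rcases Nat.lt_succ_iff_lt_or_eq.1 hi with h1 | h1
        · rcases hD i h1 with h2 | h2
          · exact Or.inl ⟨h2, by omega⟩
          · exact Or.inr ⟨h2, by omega⟩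
        · subst h1; exact Or.inl ⟨hN, by omega⟩)
      rw [Finset.sum_range_succ, Finset.sum_range_succ] at this
      rw [Finset.sum_range_succ]
      have e : ∑ i ∈ Finset.range N, (if D i ∧ i ≠ N + 1 then b i else 0) =
          ∑ i ∈ Finset.range N, (if D i then b' i else 0) := by
        refine Finset.sum_congr rfl fun i hi => ?_
        have := Finset.mem_range.1 hi
        have h1 : i ≠ N + 1 := by omega
        have h2 : i ≠ N := by omega
        simp [hb', h1, h2]
      rw [e] at this
      simp [hN, hb'] at this ⊢
      omega
    obtain ⟨y, hy0, hyN, hy, hs⟩ := ih b' (s - w) (by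
      intro D _ hD
      by_cases hN : D N
      · exact key D hN hD
      · by_cases hlt : b N ≤ b (N+1)
        · have hz : b' N = 0 := by simp [hb']; omega
          have := key (fun i => D i ∨ i = N) (Or.inr rfl) (fun i hi => (hD i hi).imp Or.inl Or.inl)
          refine this.trans (Finset.sum_le_sum fun i _ => ?_)
          by_cases hi : i = N
          · subst hi; simp [hz]
          · simp [hi]
        · have := h (fun i => D i ∧ i ≠ N + 1 ∨ i = N + 1) (by
            intro i hi
            rcases Nat.lt_succ_iff_lt_or_eq.1 hi with h1 | h1
            · rcases hD i h1 with h2 | h2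
              · exact Or.inl (Or.inl ⟨h2, by omega⟩)
              · exact Or.inr (Or.inl ⟨h2, by omega⟩)
            · subst h1; exact Or.inr (Or.inr rfl))
          rw [Finset.sum_range_succ] at this
          have e : ∑ i ∈ Finset.range (N+1), (if D i ∧ i ≠ N + 1 ∨ i = N + 1 then b i else 0) =
              ∑ i ∈ Finset.range (N+1), (if D i then b' i else 0) := by
            refine Finset.sum_congr rfl fun i hi => ?_
            have := Finset.mem_range.1 hi
            have h1 : i ≠ N + 1 := by omega
            by_cases h2 : i = N
            · subst h2; simp [hN]
            · simp [hb', h1, h2]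
          rw [e] at this
          simp at this
          omega)
    refine ⟨fun i => if i = N + 1 then w else if i = N + 2 then 0 else y i, by simp [hy0], by simp, ?_, ?_⟩
    · intro i hi
      have h3 := hy i
      simp only [hb'] at h3
      rcases Nat.lt_trichotomy i N with h1 | h1 | h1
      · have := h3 h1.le
        rw [if_neg (by omega)] at this
        simp only []
        rw [if_neg (by omega), if_neg (by omega), if_neg (by omega), if_neg (by omega)]
        exact this
      · subst h1
        have := h3 le_rfl
        simp [hyN] at this
        have hwb : w ≤ b i := min_le_right _ _
        simp
        omega
      · have : i = N + 1 := by omega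
        subst this
        simp [hw]
    · rw [Finset.sum_range_succ]
      have e : ∑ i ∈ Finset.range (N+1), (if i = N + 1 then w else if i = N + 2 then 0 else y i) =
          ∑ i ∈ Finset.range (N+1), y i := by
        refine Finset.sum_congr rfl fun i hi => ?_
        have := Finset.mem_range.1 hi
        rw [if_neg (by omega), if_neg (by omega)]
      rw [e]
      simp
      omega

theorem sum_zmod (M : ℕ) [NeZero M] {A : Type*} [AddCommMonoid A] (f : ZMod M → A) (c : ZMod M) :
    ∑ i, f i = ∑ l ∈ Finset.range M, f (c + (l : ZMod M)) := by
  rw [← Equiv.sum_comp (Equiv.addLeft c) f]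
  refine Finset.sum_bij' (fun i _ => i.val) (fun l _ => (l : ZMod M)) ?_ ?_ ?_ ?_ ?_
  · intro a _; simpa using ZMod.val_lt a
  · simp
  · simp
  · intro l hl; simpa using ZMod.val_cast_of_lt (Finset.mem_range.1 hl)
  · simp

theorem z_rec (n : ℕ) (a : ZMod (2*n+1) → ℤ) (i : ZMod (2*n+1)) :
    (∑ l ∈ Finset.range (2*n+1), (-1:ℤ)^l * a (i + 1 + (l : ZMod (2*n+1)))) +
    (∑ l ∈ Finset.range (2*n+1), (-1:ℤ)^l * a (i + 1 + 1 + (l : ZMod (2*n+1)))) = 2 * a (i + 1) := by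
  rw [Finset.sum_range_succ' (fun l => (-1:ℤ)^l * a (i + 1 + (l : ZMod (2*n+1)))),
    Finset.sum_range_succ (fun l => (-1:ℤ)^l * a (i + 1 + 1 + (l : ZMod (2*n+1))))]
  have h1 : ∑ l ∈ Finset.range (2*n), (-1:ℤ)^(l+1) * a (i + 1 + ((l+1 : ℕ) : ZMod (2*n+1))) =
      - ∑ l ∈ Finset.range (2*n), (-1:ℤ)^l * a (i + 1 + 1 + (l : ZMod (2*n+1))) := by
    rw [← Finset.sum_neg_distrib]
    refine Finset.sum_congr rfl fun l _ => ?_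
    rw [show (i + 1 + ((l+1 : ℕ) : ZMod (2*n+1))) = i + 1 + 1 + (l : ZMod (2*n+1)) by push_cast; ring]
    ring
  have h2 : (i + 1 + 1 + ((2*n : ℕ) : ZMod (2*n+1))) = i + 1 := by
    have : ((2*n+1 : ℕ) : ZMod (2*n+1)) = 0 := ZMod.natCast_self _
    push_cast at this ⊢
    linear_combination this
  rw [h1, h2]
  simp [pow_mul]
  ring

theorem cyc_lemma (n : ℕ) (a : ZMod (2*n+1) → ℕ) (s : ℕ)
    (h : ∀ (D : ZMod (2*n+1) → Prop) [DecidablePred D], (∀ i, D i ∨ D (i+1)) →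
      s ≤ ∑ i, if D i then a i else 0) :
    ∃ (t : ℕ) (y : ZMod (2*n+1) → ℕ), (∀ i, t + y i + y (i-1) ≤ a i) ∧
      s ≤ t * (n+1) + ∑ i, y i := by
  classical
  set z : ZMod (2*n+1) → ℤ := fun i =>
    ∑ l ∈ Finset.range (2*n+1), (-1:ℤ)^l * (a (i + 1 + (l : ZMod (2*n+1))) : ℤ) with hz
  have hrec : ∀ i, z i + z (i+1) = 2 * a (i+1) := fun i => z_rec n (fun i => (a i : ℤ)) i
  have hM0 : ((2*n+1 : ℕ) : ZMod (2*n+1)) = 0 := ZMod.natCast_self _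
  obtain ⟨j, -, hj⟩ := Finset.exists_min_image Finset.univ z ⟨0, Finset.mem_univ _⟩
  replace hj : ∀ i, z j ≤ z i := fun i => hj i (Finset.mem_univ i)
  have hcov : ∀ i : ZMod (2*n+1), ∃ p < 2*n+1, i = j + 1 + (p : ZMod (2*n+1)) := by
    intro i
    exact ⟨(i - (j+1)).val, ZMod.val_lt _, by simp⟩
  have hval : ∀ p < 2*n+1, (j + 1 + (p : ZMod (2*n+1)) - (j+1)).val = p := by
    intro p hp
    rw [add_sub_cancel_left]
    exact ZMod.val_cast_of_lt hp
  -- translation of covers of the cut-open cycle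
  have htr : ∀ (D : ℕ → Prop) [DecidablePred D], (∀ i < 2*n, D i ∨ D (i+1)) → (D (2*n) ∨ D 0) →
      s ≤ ∑ p ∈ Finset.range (2*n+1), if D p then a (j + 1 + (p : ZMod (2*n+1))) else 0 := by
    intro D _ hD hD0
    have := h (fun i => D (i - (j+1)).val) (by
      intro i
      obtain ⟨p, hp, rfl⟩ := hcov i
      rw [hval p hp]
      by_cases hp2 : p = 2*n
      · subst hp2
        have : (j + 1 + ((2*n : ℕ) : ZMod (2*n+1)) + 1 - (j+1)).val = 0 := by
          rw [ZMod.val_eq_zero]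
          push_cast at hM0 ⊢
          linear_combination hM0
        rw [this]; exact hD0
      · have : (j + 1 + (p : ZMod (2*n+1)) + 1 - (j+1)).val = p + 1 := by
          rw [show j + 1 + (p : ZMod (2*n+1)) + 1 - (j+1) = ((p+1 : ℕ) : ZMod (2*n+1)) by
            push_cast; ring]
          exact ZMod.val_cast_of_lt (by omega)
        rw [this]; exact hD p (by omega))
    rw [sum_zmod _ _ (j+1)] at this
    refine this.trans (Finset.sum_le_sum fun p hp => ?_)
    simp only [hval p (Finset.mem_range.1 hp)]
    exact le_rfl
  -- even/odd sign
  have hsum : ∑ i, z i = ∑ i, (a i : ℤ) := by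
    have e1 : ∑ i, (z i + z (i+1)) = ∑ i, 2 * (a (i+1) : ℤ) :=
      Finset.sum_congr rfl fun i _ => hrec i
    have hsh : ∀ f : ZMod (2*n+1) → ℤ, ∑ i, f (i+1) = ∑ i, f i :=
      fun f => Equiv.sum_comp (Equiv.addRight (1 : ZMod (2*n+1))) f
    rw [Finset.sum_add_distrib, hsh z, ← Finset.mul_sum, hsh (fun i => (a i : ℤ))] at e1
    linarith
  by_cases hneg : z j < 0
  · -- path case
    obtain ⟨y, hy0, hyN, hy, hys⟩ := path_lemma (2*n) (fun p => a (j + 1 + (p : ZMod (2*n+1)))) s (by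
      intro D _ hD
      by_cases hD0 : D (2*n) ∨ D 0
      · exact htr D hD hD0
      push Not at hD0
      have hex : ∃ q, (Even q ∧ D q) ∨ q = 2*n+1 := ⟨2*n+1, Or.inr rfl⟩
      obtain ⟨q, hq, hqmin⟩ : ∃ q, ((Even q ∧ D q) ∨ q = 2*n+1) ∧
          ∀ p < q, ¬ ((Even p ∧ D p) ∨ p = 2*n+1) :=
        ⟨Nat.find hex, Nat.find_spec hex, fun p hp => Nat.find_min hex hp⟩
      have hq1 : q ≤ 2*n+1 := by
        by_contra hc
        exact hqmin (2*n+1) (by omega) (Or.inr rfl)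
      have hq0 : 0 < q := by
        rcases Nat.eq_zero_or_pos q with h0 | h0
        · subst h0
          rcases hq with h1 | h1
          · exact absurd h1.2 hD0.2
          · omega
        · exact h0
      have hpre : ∀ p < q, (D p ↔ ¬ Even p) := by
        intro p hp
        constructor
        · intro h1 h2
          exact hqmin p hp (Or.inl ⟨h2, h1⟩)
        · intro h2
          have hp0 : p ≠ 0 := by rintro rfl; simp at h2
          rcases hD (p-1) (by omega) with h3 | h3
          · exfalso
            refine hqmin (p-1) (by omega) (Or.inl ⟨?_, h3⟩)
            rw [Nat.not_even_iff_odd] at h2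
            obtain ⟨c, rfl⟩ := h2
            simp
          · rwa [Nat.sub_add_cancel (by omega)] at h3
      have hpart : ∀ q, 2 * ∑ p ∈ Finset.range q, (-1:ℤ)^p * (a (j + 1 + (p : ZMod (2*n+1))) : ℤ) =
          z j - (-1:ℤ)^q * z (j + (q : ZMod (2*n+1))) := by
        intro q
        induction q with
        | zero => simp
        | succ q ih =>
          rw [Finset.sum_range_succ, mul_add, ih]
          have := hrec (j + (q : ZMod (2*n+1)))
          rw [show j + (q : ZMod (2*n+1)) + 1 = j + 1 + (q : ZMod (2*n+1)) by ring] at this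
          rw [show j + ((q+1 : ℕ) : ZMod (2*n+1)) = j + 1 + (q : ZMod (2*n+1)) by push_cast; ring,
            pow_succ]
          linear_combination (-(-1:ℤ)^q) * this
      have hle : ∑ p ∈ Finset.range q, (-1:ℤ)^p * (a (j + 1 + (p : ZMod (2*n+1))) : ℤ) ≤ 0 := by
        have h1 := hpart q
        rcases hq with h2 | h2
        · rw [h2.1.neg_one_pow] at h1
          have := hj (j + (q : ZMod (2*n+1)))
          linarith
        · rw [h2] at h1 ⊢
          rw [hM0, (show Odd (2*n+1) by simp).neg_one_pow] at h1
          simp only [add_zero] at h1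
          linarith
      have h1 := htr (fun p => (p < q ∧ Even p) ∨ (q ≤ p ∧ D p)) (by
        intro i hi
        by_cases h1 : i + 1 < q
        · by_cases h2 : Even i
          · exact Or.inl (Or.inl ⟨by omega, h2⟩)
          · exact Or.inr (Or.inl ⟨h1, by rw [Nat.even_add_one]; exact h2⟩)
        · by_cases h2 : q ≤ i
          · rcases hD i hi with h3 | h3
            · exact Or.inl (Or.inr ⟨h2, h3⟩)
            · exact Or.inr (Or.inr ⟨by omega, h3⟩)
          · have h3 : q = i + 1 := by omega
            rcases hq with h4 | h4
            · exact Or.inr (Or.inr ⟨by omega, h3 ▸ h4.2⟩)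
            · omega) (Or.inr (Or.inl ⟨hq0, by simp⟩))
      refine h1.trans ?_
      have hsplit : ∀ f : ℕ → ℤ, ∑ p ∈ Finset.range (2*n+1), f p =
          ∑ p ∈ Finset.range q, f p + ∑ p ∈ Finset.Ico q (2*n+1), f p := by
        intro f
        rw [Finset.sum_range_add_sum_Ico _ hq1]
      zify
      rw [hsplit, hsplit]
      refine add_le_add ?_ (le_of_eq ?_)
      · rw [← sub_nonpos, ← Finset.sum_sub_distrib]
        refine le_trans (le_of_eq (Finset.sum_congr rfl fun p hp => ?_)) hle
        have hp := Finset.mem_range.1 hp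
        by_cases h2 : Even p
        · simp [hp, h2, hpre p hp]
        · simp [hp, h2, hpre p hp, (Nat.not_even_iff_odd.1 h2).neg_one_pow]
      · refine Finset.sum_congr rfl fun p hp => ?_
        have hp := (Finset.mem_Ico.1 hp).1
        simp [hp, Nat.not_lt.2 hp])
    refine ⟨0, fun v => y ((v - (j+1)).val + 1), ?_, ?_⟩
    · intro i
      obtain ⟨p, hp, rfl⟩ := hcov i
      have h1 := hy p (by omega)
      beta_reduce
      rw [hval p hp]
      rcases Nat.eq_zero_or_pos p with h0 | h0
      · subst h0
        have : (j + 1 + ((0 : ℕ) : ZMod (2*n+1)) - 1 - (j+1)).val = 2*n := by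
          rw [show j + 1 + ((0 : ℕ) : ZMod (2*n+1)) - 1 - (j+1) = ((2*n : ℕ) : ZMod (2*n+1)) by
            push_cast at hM0 ⊢
            linear_combination -hM0]
          exact ZMod.val_cast_of_lt (by omega)
        rw [this, hyN]
        omega
      · have : (j + 1 + (p : ZMod (2*n+1)) - 1 - (j+1)).val = p - 1 := by
          rw [show j + 1 + (p : ZMod (2*n+1)) - 1 - (j+1) = ((p-1 : ℕ) : ZMod (2*n+1)) by
            rw [Nat.cast_sub h0]; push_cast; ring]
          exact ZMod.val_cast_of_lt (by omega)
        rw [this, Nat.sub_add_cancel h0]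
        omega
    · rw [sum_zmod _ _ (j+1)]
      have : ∑ p ∈ Finset.range (2*n+1), y ((j + 1 + (p : ZMod (2*n+1)) - (j+1)).val + 1) =
          ∑ p ∈ Finset.range (2*n+1), y (p+1) :=
        Finset.sum_congr rfl fun p hp => by rw [hval p (Finset.mem_range.1 hp)]
      rw [this]
      have e1 := Finset.sum_range_succ' y (2*n+1)
      have e2 := Finset.sum_range_succ y (2*n+1)
      omega
  · -- explicit case
    push Not at hneg
    have hpar : ∀ i, ∃ w : ℕ, z i = z j + 2 * w := by
      have hp : ∀ q : ℕ, ∃ w : ℤ, z (j + (q : ZMod (2*n+1))) = z j + 2 * w := by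
        intro q
        induction q with
        | zero => exact ⟨0, by simp⟩
        | succ q ih =>
          obtain ⟨w, hw⟩ := ih
          have := hrec (j + (q : ZMod (2*n+1)))
          refine ⟨a (j + (q : ZMod (2*n+1)) + 1) - z j - w, ?_⟩
          rw [show j + ((q+1 : ℕ) : ZMod (2*n+1)) = j + (q : ZMod (2*n+1)) + 1 by push_cast; ring]
          linarith
      intro i
      obtain ⟨w, hw⟩ := hp (i - j).val
      rw [ZMod.natCast_zmod_val, add_sub_cancel] at hw
      have := hj i
      exact ⟨w.toNat, by rw [Int.toNat_of_nonneg (by linarith)]; exact hw⟩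
    choose w hw using hpar
    obtain ⟨t, ht⟩ := Int.eq_ofNat_of_zero_le hneg
    refine ⟨t, w, ?_, ?_⟩
    · intro i
      have h1 := hrec (i-1)
      rw [sub_add_cancel, hw i, hw (i-1), ht] at h1
      omega
    · have h1 := htr (fun p => Even p) (by
        intro i _
        by_cases h2 : Even i
        · exact Or.inl h2
        · exact Or.inr (by rw [Nat.even_add_one]; exact h2)) (Or.inl (by simp))
      have h2 : 2 * ∑ p ∈ Finset.range (2*n+1),
          (if Even p then (a (j + 1 + (p : ZMod (2*n+1))) : ℤ) else 0) = ∑ i, (a i : ℤ) + z j := by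
        rw [sum_zmod _ _ (j+1), hz, ← Finset.sum_add_distrib, Finset.mul_sum]
        refine Finset.sum_congr rfl fun p _ => ?_
        by_cases h2 : Even p
        · simp [h2]; ring
        · simp [h2, (Nat.not_even_iff_odd.1 h2).neg_one_pow]
      zify at h1 ⊢
      rw [← hsum] at h2
      have h3 : ∑ i, z i = (2*n+1) * z j + 2 * ∑ i, (w i : ℤ) := by
        rw [Finset.sum_congr rfl fun i _ => hw i, Finset.sum_add_distrib, ← Finset.mul_sum]
        simp
      rw [h3, ht] at h2
      linarith

/-- The substitution multiplying the variables of `C` by a new variable. -/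
def psi (𝕜 : Type) [Field 𝕜] {V : Type} (C : V → Prop) [DecidablePred C] :
    MvPolynomial V 𝕜 →ₐ[𝕜] Polynomial (MvPolynomial V 𝕜) :=
  aeval (fun v => Polynomial.X ^ (if C v then 1 else 0) * Polynomial.C (X v))

theorem psi_monomial {𝕜 : Type} [Field 𝕜] {V : Type} [Fintype V] (C : V → Prop) [DecidablePred C]
    (m : V →₀ ℕ) (a : 𝕜) : psi 𝕜 C (monomial m a) =
      Polynomial.monomial (∑ v, if C v then m v else 0) (monomial m a) := by
  rw [psi, aeval_monomial, Finsupp.prod_fintype _ _ (by simp)]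
  simp_rw [mul_pow, ← pow_mul, Finset.prod_mul_distrib, Finset.prod_pow_eq_pow_sum,
    ite_mul, one_mul, zero_mul, ← Polynomial.C_pow, ← map_prod]
  rw [monomial_eq (s := m), Finsupp.prod_fintype _ _ (by simp), ← Polynomial.C_mul_X_pow_eq_monomial,
    map_mul, Polynomial.algebraMap_apply, MvPolynomial.algebraMap_eq]
  ring

theorem psi_coeff {𝕜 : Type} [Field 𝕜] {V : Type} [Fintype V] (C : V → Prop) [DecidablePred C]
    (f : MvPolynomial V 𝕜) (d : ℕ) (m : V →₀ ℕ) :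
    ((psi 𝕜 C f).coeff d).coeff m = if (∑ v, if C v then m v else 0) = d then f.coeff m else 0 := by
  classical
  induction f using MvPolynomial.induction_on' with
  | monomial u a =>
    rw [psi_monomial, Polynomial.coeff_monomial]
    by_cases hum : u = m
    · subst hum
      split_ifs <;> simp
    · split_ifs <;> simp [coeff_monomial, hum]
  | add p q hp hq =>
    rw [map_add, Polynomial.coeff_add, coeff_add, hp, hq, coeff_add]
    split_ifs <;> simp

theorem symb_cov {𝕜 : Type} [Field 𝕜] {V : Type} [Fintype V] (G : SimpleGraph V) (s : ℕ)
    (f : MvPolynomial V 𝕜) (hf : f ∈ symbolicPower (edgeIdeal 𝕜 G) s) (m : V →₀ ℕ)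
    (hm : m ∈ f.support) (C : V → Prop) [DecidablePred C] (hC : ∀ u v, G.Adj u v → C u ∨ C v) :
    s ≤ ∑ v, if C v then m v else 0 := by
  classical
  obtain ⟨D, hDC, hD, hDmin⟩ := exists_minimal_le_of_wellFoundedLT
    (fun D : Set V => ∀ u v, G.Adj u v → u ∈ D ∨ v ∈ D) {v | C v} hC
  set P : Ideal (MvPolynomial V 𝕜) :=
    Ideal.comap (psi 𝕜 (· ∈ D)) (Ideal.span {(Polynomial.X : Polynomial (MvPolynomial V 𝕜))}) with hP
  have hPp : P.IsPrime := by
    have : (Ideal.span {(Polynomial.X : Polynomial (MvPolynomial V 𝕜))}).IsPrime :=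
      (Ideal.span_singleton_prime Polynomial.X_ne_zero).2 Polynomial.prime_X
    exact Ideal.comap_isPrime _ _
  have hPmem : ∀ u, u ∈ P ↔ (Polynomial.X : Polynomial (MvPolynomial V 𝕜)) ∣ psi 𝕜 (· ∈ D) u := by
    intro u
    rw [hP, Ideal.mem_comap, Ideal.mem_span_singleton]
  have hPX : ∀ v, X v ∈ P ↔ v ∈ D := by
    intro v
    rw [hPmem, Polynomial.X_dvd_iff, psi, aeval_X]
    by_cases hv : v ∈ D <;> simp [hv]
  have hPle : ∀ q : Ideal (MvPolynomial V 𝕜), (∀ v ∈ D, X v ∈ q) → P ≤ q := by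
    intro q hq u hu
    rw [hPmem, Polynomial.X_dvd_iff] at hu
    have : Ideal.span (X '' D) ≤ q := Ideal.span_le.2 (by rintro _ ⟨v, hv, rfl⟩; exact hq v hv)
    refine this (mem_ideal_span_X_image.2 fun m hm => ?_)
    by_contra hc
    push Not at hc
    have h1 := psi_coeff (· ∈ D) u 0 m
    rw [hu, coeff_zero, if_pos] at h1
    · exact (mem_support_iff.1 hm) h1.symm
    · refine Finset.sum_eq_zero fun v _ => ?_
      split_ifs with hv
      · exact hc v hv
      · rfl
  have hIP : edgeIdeal 𝕜 G ≤ P := by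
    refine Ideal.span_le.2 ?_
    rintro _ ⟨u, v, huv, rfl⟩
    rcases hD u v huv with h1 | h1
    · exact P.mul_mem_right _ ((hPX u).2 h1)
    · exact P.mul_mem_left _ ((hPX v).2 h1)
  have hmin : P ∈ (edgeIdeal 𝕜 G).minimalPrimes := by
    refine ⟨⟨hPp, hIP⟩, ?_⟩
    rintro q ⟨hq, hIq⟩ hqP
    refine hPle q fun v hv => ?_
    refine hDmin (y := {v | X v ∈ q}) ?_ ?_ hv
    · intro u v huv
      exact hq.mem_or_mem (hIq (Ideal.subset_span ⟨u, v, huv, rfl⟩))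
    · intro v hv
      exact (hPX v).1 (hqP hv)
  have hass : P ∈ associatedPrimes (MvPolynomial V 𝕜) (MvPolynomial V 𝕜 ⧸ edgeIdeal 𝕜 G) := by
    apply Module.associatedPrimes.minimalPrimes_annihilator_subset_associatedPrimes
    rwa [Ideal.annihilator_quotient]
  have h1 : f ∈ localizationComap P hPp (edgeIdeal 𝕜 G ^ s) := by
    rw [symbolicPower, Submodule.mem_sInf] at hf
    exact hf _ ⟨P, hPp, hass, rfl⟩
  rw [localizationComap, Ideal.mem_comap,
    IsLocalization.algebraMap_mem_map_algebraMap_iff P.primeCompl] at h1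
  obtain ⟨u, hu, huf⟩ := h1
  have h2 : psi 𝕜 (· ∈ D) (u * f) ∈ Ideal.span {(Polynomial.X : Polynomial (MvPolynomial V 𝕜)) ^ s} := by
    rw [← Ideal.span_singleton_pow]
    have : Ideal.map (psi 𝕜 (· ∈ D)) (edgeIdeal 𝕜 G ^ s) ≤
        Ideal.span {(Polynomial.X : Polynomial (MvPolynomial V 𝕜))} ^ s := by
      rw [Ideal.map_pow]
      exact Ideal.pow_right_mono (Ideal.map_le_iff_le_comap.2 hIP) s
    exact this (Ideal.mem_map_of_mem _ huf)
  rw [Ideal.mem_span_singleton, map_mul] at h2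
  have h3 := Polynomial.prime_X.pow_dvd_of_dvd_mul_left s
    (fun h => hu ((hPmem u).2 h)) h2
  rw [Polynomial.X_pow_dvd_iff] at h3
  have h4 : s ≤ ∑ v, if v ∈ D then m v else 0 := by
    by_contra hc
    push Not at hc
    have h5 := psi_coeff (· ∈ D) f (∑ v, if v ∈ D then m v else 0) m
    rw [if_pos rfl, h3 _ hc, coeff_zero] at h5
    exact (mem_support_iff.1 hm) h5.symm
  refine h4.trans (Finset.sum_le_sum fun v _ => ?_)
  by_cases hv : v ∈ D
  · have : C v := hDC hv
    simp [hv, this]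
  · simp [hv]

theorem prod_zmod (M : ℕ) [NeZero M] {A : Type*} [CommMonoid A] (f : ZMod M → A) (c : ZMod M) :
    ∏ i, f i = ∏ l ∈ Finset.range M, f (c + (l : ZMod M)) := by
  rw [← Equiv.prod_comp (Equiv.addLeft c) f]
  refine Finset.prod_bij' (fun i _ => i.val) (fun l _ => (l : ZMod M)) ?_ ?_ ?_ ?_ ?_
  · intro a _; simpa using ZMod.val_lt a
  · simp
  · simp
  · intro l hl; simpa using ZMod.val_cast_of_lt (Finset.mem_range.1 hl)
  · simp

theorem prod_pairs {A : Type*} [CommMonoid A] (n : ℕ) (g : ℕ → A) :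
    ∏ l ∈ Finset.range (2*n), g l = ∏ l ∈ Finset.range n, (g (2*l) * g (2*l+1)) := by
  induction n with
  | zero => simp
  | succ n ih =>
    rw [show 2*(n+1) = 2*n+1+1 by ring, Finset.prod_range_succ, Finset.prod_range_succ, ih,
      Finset.prod_range_succ, mul_assoc]

theorem edge_mem (𝕜 : Type) [Field 𝕜] {V : Type} (G : SimpleGraph V) {u v : V} (h : G.Adj u v) :
    (X u * X v : MvPolynomial V 𝕜) ∈ edgeIdeal 𝕜 G :=
  Ideal.subset_span ⟨u, v, h, rfl⟩

theorem prod_mem_pow {A : Type*} [CommRing A] (I : Ideal A) {ι : Type*} (S : Finset ι) (f : ι → A)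
    (y : ι → ℕ) (h : ∀ i ∈ S, f i ∈ I) : ∏ i ∈ S, f i ^ y i ∈ I ^ (∑ i ∈ S, y i) := by
  rw [← Finset.prod_pow_eq_pow_sum]
  exact Ideal.prod_mem_prod fun i hi => Ideal.pow_mem_pow (h i hi) _

theorem cycle_factor (𝕜 : Type) [Field 𝕜] {V : Type} (G : SimpleGraph V) (n : ℕ)
    (x : ZMod (2 * n + 1) → V) (hadj : ∀ i, G.Adj (x i) (x (i+1))) (j : ZMod (2*n+1)) :
    ∃ q ∈ edgeIdeal 𝕜 G ^ n, ∏ i, (X (x i) : MvPolynomial V 𝕜) = X (x j) * q := by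
  refine ⟨∏ l ∈ Finset.range n, (X (x (j + ((2*l+1 : ℕ) : ZMod (2*n+1)))) *
    X (x (j + ((2*l+1+1 : ℕ) : ZMod (2*n+1))))) ^ 1, ?_, ?_⟩
  · have := prod_mem_pow (edgeIdeal 𝕜 G) (Finset.range n)
      (fun l => (X (x (j + ((2*l+1 : ℕ) : ZMod (2*n+1)))) *
        X (x (j + ((2*l+1+1 : ℕ) : ZMod (2*n+1)))) : MvPolynomial V 𝕜)) (fun _ => 1) (by
      intro l _
      apply edge_mem
      have := hadj (j + ((2*l+1 : ℕ) : ZMod (2*n+1)))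
      rwa [show j + ((2*l+1 : ℕ) : ZMod (2*n+1)) + 1 = j + ((2*l+1+1 : ℕ) : ZMod (2*n+1)) by
        push_cast; ring] at this)
    simpa using this
  · rw [prod_zmod _ _ j, Finset.prod_range_succ',
      prod_pairs n (fun l => (X (x (j + ((l+1 : ℕ) : ZMod (2*n+1)))) : MvPolynomial V 𝕜))]
    simp only [pow_one, Nat.cast_zero, add_zero]
    rw [mul_comm]

theorem leaf_unique {V : Type} [Fintype V] (G : SimpleGraph V) (n : ℕ) (hn : 1 ≤ n)
    (x : ZMod (2 * n + 1) → V) (hx : IsUnicyclicOddCycle G n x)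
    (hN : ∀ v : V, (∃ j : ZMod (2 * n + 1), v = x j) ∨
      ∃ j : ZMod (2 * n + 1), G.Adj v (x j)) (v : V) (hv : ∀ i, v ≠ x i) (w w' : V)
    (hw : G.Adj v w) (hw' : G.Adj v w') : w = w' := by
  classical
  have hex : ∀ v, ∃ w, G.Adj v w ∧ (∃ j, w = x j) ∧ (∀ i, v = x i → w = x (i+1)) := by
    intro v
    by_cases h : ∃ j, v = x j
    · obtain ⟨j, rfl⟩ := h
      exact ⟨x (j+1), (hx.adj_iff _ _).2 (Or.inl rfl), ⟨_, rfl⟩, fun i hi => by rw [hx.inj hi]⟩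
    · obtain ⟨j, hj⟩ := (hN v).resolve_left h
      exact ⟨x j, hj, ⟨j, rfl⟩, fun i hi => absurd ⟨i, hi⟩ h⟩
  choose nb hnb hnbx hnb1 using hex
  have h2 : (2 : ZMod (2*n+1)) ≠ 0 := by
    intro h0
    have : ((2 : ℕ) : ZMod (2*n+1)) = 0 := by exact_mod_cast h0
    rw [ZMod.natCast_eq_zero_iff] at this
    have := Nat.le_of_dvd (by norm_num) this
    omega
  let φ : V → G.edgeSet := fun u => ⟨s(u, nb u), hnb u⟩
  have hinj : Function.Injective φ := by
    intro u u' h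
    have h1 : s(u, nb u) = s(u', nb u') := congrArg Subtype.val h
    rw [Sym2.eq_iff] at h1
    rcases h1 with h1 | ⟨h1, h3⟩
    · exact h1.1
    · exfalso
      obtain ⟨j, hj⟩ := hnbx u
      obtain ⟨j', hj'⟩ := hnbx u'
      have e1 : u = x j' := h1.trans hj'
      have e2 : u' = x j := h3.symm.trans hj
      have e3 := hnb1 u j' e1
      have e4 := hnb1 u' j e2
      rw [hj] at e3
      rw [hj'] at e4
      have e5 := hx.inj e3
      have e6 := hx.inj e4
      apply h2
      linear_combination -e5 - e6
  have hbij : Function.Bijective φ := by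
    haveI : Fintype G.edgeSet := Fintype.ofFinite _
    rw [Fintype.bijective_iff_injective_and_card]
    refine ⟨hinj, ?_⟩
    rw [← hx.edge_count, ← Nat.card_coe_set_eq, Nat.card_eq_fintype_card]
  have key : ∀ w, G.Adj v w → w = nb v := by
    intro w hw
    obtain ⟨u, hu⟩ := hbij.2 ⟨s(v, w), hw⟩
    have h1 : s(u, nb u) = s(v, w) := congrArg Subtype.val hu
    rw [Sym2.eq_iff] at h1
    rcases h1 with ⟨h1, h3⟩ | ⟨h1, h3⟩
    · rw [← h1, h3]
    · obtain ⟨j, hj⟩ := hnbx u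
      exact absurd (h3.symm.trans hj) (hv j)
  rw [key w hw, key w' hw']

theorem weight_sub {V : Type} [Fintype V] [DecidableEq V] (m : V →₀ ℕ) (v w : V)
    (C : V → Prop) [DecidablePred C] :
    (∑ u, if C u then (m + Finsupp.single v 1 + Finsupp.single w 1 : V →₀ ℕ) u else 0) =
      (∑ u, if C u then m u else 0) + (if C v then 1 else 0) + (if C w then 1 else 0) := by
  have h1 : ∀ v : V, (∑ u, if C u then (Finsupp.single v 1 : V →₀ ℕ) u else 0) =
      if C v then 1 else 0 := by
    intro v
    rw [Finset.sum_eq_single v]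
    · simp
    · intro b _ hb
      simp [Finsupp.single_apply, hb.symm]
    · simp
  rw [← h1 v, ← h1 w, ← Finset.sum_add_distrib, ← Finset.sum_add_distrib]
  refine Finset.sum_congr rfl fun u _ => ?_
  split_ifs <;> simp

theorem mono_mem {V : Type} [Fintype V] (𝕜 : Type) [Field 𝕜]
    (G : SimpleGraph V) (n : ℕ)
    (x : ZMod (2 * n + 1) → V) (hx : IsUnicyclicOddCycle G n x)
    (hleaf : ∀ v, (∀ i, v ≠ x i) → ∀ w w', G.Adj v w → G.Adj v w' → w = w') (s : ℕ) :
    ∀ m : V →₀ ℕ, (∀ (C : V → Prop) [DecidablePred C], (∀ u v, G.Adj u v → C u ∨ C v) →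
      s ≤ ∑ v, if C v then m v else 0) →
    ∃ (t e : ℕ), ∃ g ∈ edgeIdeal 𝕜 G ^ e, s ≤ t * (n+1) + e ∧
      (monomial m 1 : MvPolynomial V 𝕜) = (∏ i, X (x i)) ^ t * g := by
  classical
  induction s with
  | zero =>
    intro m _
    exact ⟨0, 0, monomial m 1, by simp, by simp, by simp⟩
  | succ s ih =>
    intro m hm
    by_cases hl : ∃ v w, (∀ i, v ≠ x i) ∧ G.Adj v w ∧ m v ≠ 0 ∧ m w ≠ 0
    · obtain ⟨v, w, hv, hvw, hmv, hmw⟩ := hl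
      obtain ⟨m', rfl⟩ : ∃ m' : V →₀ ℕ, m = m' + Finsupp.single v 1 + Finsupp.single w 1 := by
        refine ⟨m - (Finsupp.single v 1 + Finsupp.single w 1), ?_⟩
        rw [add_assoc, tsub_add_cancel_of_le]
        intro u
        have hne := hvw.ne
        by_cases h1 : v = u
        · subst h1
          simp [Finsupp.single_apply, hne.symm]
          omega
        · by_cases h2 : w = u
          · subst h2
            simp [Finsupp.single_apply, hne]
            omega
          · simp [Finsupp.single_apply, h1, h2]
      obtain ⟨t, e, g, hg, hs, hmon⟩ := ih m' (by
        intro C _ hC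
        by_cases hb : C v ∧ C w
        · have h1 := hm (fun u => C u ∧ u ≠ v) (by
            intro a b hab
            by_cases hav : a = v
            · subst hav
              rw [hleaf a hv b w hab hvw]
              exact Or.inr ⟨hb.2, hvw.ne.symm⟩
            · by_cases hbv : b = v
              · subst hbv
                rw [hleaf b hv a w hab.symm hvw]
                exact Or.inl ⟨hb.2, hvw.ne.symm⟩
              · exact (hC a b hab).imp (fun h => ⟨h, hav⟩) (fun h => ⟨h, hbv⟩))
          rw [weight_sub] at h1
          have h2 : (∑ u, if C u ∧ u ≠ v then m' u else 0) ≤ ∑ u, if C u then m' u else 0 := by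
            refine Finset.sum_le_sum fun u _ => ?_
            by_cases hu : C u <;> by_cases hu' : u = v <;> simp [hu, hu']
          rw [if_neg (by simp)] at h1
          split_ifs at h1 <;> omega
        · have h1 := hm C hC
          rw [weight_sub] at h1
          split_ifs at h1 <;> first | omega | (exfalso; tauto))
      refine ⟨t, e+1, g * (X v * X w), ?_, by omega, ?_⟩
      · rw [pow_succ]
        exact Ideal.mul_mem_mul hg (edge_mem 𝕜 G hvw)
      · rw [← mul_assoc, ← hmon, X, X, ← mul_assoc, monomial_mul, monomial_mul]
        simp
    · have hl' : ∀ v w, (∀ i, v ≠ x i) → G.Adj v w → m v = 0 ∨ m w = 0 := by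
        intro v w h1 h2
        by_contra h3
        push Not at h3
        exact hl ⟨v, w, h1, h2, h3.1, h3.2⟩
      obtain ⟨t, y, hy, hs⟩ := cyc_lemma n (fun i => m (x i)) (s+1) (by
        intro D _ hD
        have h1 := hm (fun v => m v = 0 ∨ ∃ i, D i ∧ v = x i) (by
          intro u w huw
          by_cases hu : ∃ i, u = x i
          · by_cases hw : ∃ i, w = x i
            · obtain ⟨i, rfl⟩ := hu
              obtain ⟨i', rfl⟩ := hw
              rcases (hx.adj_iff _ _).1 huw with rfl | rfl
              · exact (hD i).imp (fun h => Or.inr ⟨_, h, rfl⟩) (fun h => Or.inr ⟨_, h, rfl⟩)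
              · exact (hD i').symm.imp (fun h => Or.inr ⟨_, h, rfl⟩) (fun h => Or.inr ⟨_, h, rfl⟩)
            · exact (hl' w u (fun i hi => hw ⟨i, hi⟩) huw.symm).symm.imp Or.inl Or.inl
          · exact (hl' u w (fun i hi => hu ⟨i, hi⟩) huw).imp Or.inl Or.inl)
        refine h1.trans ?_
        have h2 : (∑ i, if D i then m (x i) else 0) =
            ∑ v ∈ (Finset.univ.filter D).image x, m v := by
          rw [Finset.sum_image (fun a _ b _ h => hx.inj h), Finset.sum_filter]
        rw [h2, ← Finset.sum_filter]
        rw [← Finset.sum_filter_ne_zero (s := Finset.filter _ _)]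
        refine Finset.sum_le_sum_of_subset ?_
        intro v hv
        simp only [Finset.mem_filter, Finset.mem_univ, true_and] at hv
        obtain ⟨h3, h4⟩ := hv
        obtain ⟨i, hi, rfl⟩ := h3.resolve_left h4
        exact Finset.mem_image.2 ⟨i, by simpa using hi, rfl⟩)
      refine ⟨t, ∑ i, y i, (∏ i, (X (x i) * X (x (i+1))) ^ y i) *
        ((∏ i, X (x i) ^ (m (x i) - (t + y i + y (i-1)))) *
          ∏ v ∈ (Finset.univ.image x)ᶜ, X v ^ m v), ?_, hs, ?_⟩
      · apply Ideal.mul_mem_right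
        refine prod_mem_pow _ _ _ _ fun i _ => edge_mem _ _ ?_
        exact (hx.adj_iff _ _).2 (Or.inl rfl)
      · rw [monomial_eq, Finsupp.prod_fintype _ _ (by simp), C_1, one_mul,
          ← Finset.prod_mul_prod_compl (Finset.univ.image x),
          Finset.prod_image (fun a _ b _ h => hx.inj h), ← mul_assoc, ← mul_assoc]
        congr 1
        have hsh : ∏ i, (X (x (i+1)) : MvPolynomial V 𝕜) ^ y i = ∏ i, X (x i) ^ y (i-1) := by
          have := Equiv.prod_comp (Equiv.addRight (1 : ZMod (2*n+1)))
            (fun i => (X (x i) : MvPolynomial V 𝕜) ^ y (i-1))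
          simpa using this
        simp_rw [mul_pow]
        rw [Finset.prod_mul_distrib, hsh, ← Finset.prod_pow, ← Finset.prod_mul_distrib,
          ← Finset.prod_mul_distrib, ← Finset.prod_mul_distrib]
        refine Finset.prod_congr rfl fun i _ => ?_
        rw [← pow_add, ← pow_add, ← pow_add]
        congr 1
        have := hy i
        omega

theorem exists_var_not_mem {V : Type} [Fintype V] [Nonempty V] (𝕜 : Type) [Field 𝕜]
    (G : SimpleGraph V) (p : Ideal (MvPolynomial V 𝕜))
    (hp : p ∈ associatedPrimes (MvPolynomial V 𝕜) (MvPolynomial V 𝕜 ⧸ edgeIdeal 𝕜 G)) :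
    ∃ v, (X v : MvPolynomial V 𝕜) ∉ p := by
  classical
  by_contra hc
  push Not at hc
  rw [AssociatedPrimes.mem_iff, isAssociatedPrime_iff] at hp
  obtain ⟨hpp, fb, hfb⟩ := hp
  obtain ⟨f, rfl⟩ := Ideal.Quotient.mk_surjective fb
  have hmem : ∀ g, g ∈ p ↔ g * f ∈ edgeIdeal 𝕜 G := by
    intro g
    rw [hfb, Submodule.mem_colon_singleton, Submodule.mem_bot, ← Ideal.Quotient.eq_zero_iff_mem,
      map_mul]
    rfl
  have hI : edgeIdeal 𝕜 G = Ideal.span ((fun m => monomial m (1 : 𝕜)) ''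
      {m : V →₀ ℕ | ∃ u v, G.Adj u v ∧ m = Finsupp.single u 1 + Finsupp.single v 1}) := by
    rw [edgeIdeal]
    congr 1
    ext q
    constructor
    · rintro ⟨u, v, h, rfl⟩
      exact ⟨_, ⟨u, v, h, rfl⟩, by simp [X, monomial_mul]⟩
    · rintro ⟨_, ⟨u, v, h, rfl⟩, rfl⟩
      exact ⟨u, v, h, by simp [X, monomial_mul]⟩
  have hf : f ∉ edgeIdeal 𝕜 G := by
    intro h
    exact hpp.ne_top ((Ideal.eq_top_iff_one _).2 ((hmem 1).2 (by simpa using h)))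
  rw [hI, mem_ideal_span_monomial_image] at hf
  push Not at hf
  obtain ⟨m, hm, hmin⟩ := hf
  have hstep : ∀ v, ∃ u w, G.Adj u w ∧ Finsupp.single u 1 + Finsupp.single w 1 ≤ m + Finsupp.single v 1 := by
    intro v
    have h1 := (hmem (X v)).1 (hc v)
    rw [hI, mem_ideal_span_monomial_image] at h1
    obtain ⟨_, ⟨u, w, h, rfl⟩, hle⟩ := h1 (m + Finsupp.single v 1) (by
      rw [mem_support_iff, add_comm, coeff_X_mul]
      exact mem_support_iff.1 hm)
    exact ⟨u, w, h, hle⟩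
  have hbad : ∀ v, m v = 0 := by
    intro v
    by_contra hv
    obtain ⟨u, w, h, hle⟩ := hstep v
    refine hmin _ ⟨u, w, h, rfl⟩ ?_
    intro q
    have h1 := hle q
    have hne := h.ne
    simp only [Finsupp.add_apply, Finsupp.single_apply] at h1 ⊢
    by_cases hqv : v = q
    · subst hqv
      split_ifs <;> first | omega | (exfalso; apply hne; simp_all)
    · rw [if_neg hqv] at h1
      exact h1
  obtain ⟨v⟩ := ‹Nonempty V›
  obtain ⟨u, w, h, hle⟩ := hstep v
  have h1 := hle u
  have h2 := hle w
  have hne := h.ne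
  simp only [Finsupp.add_apply, Finsupp.single_apply, hbad] at h1 h2
  have e1 : v = u := by
    by_contra hh
    simp [hh] at h1
  have e2 : v = w := by
    by_contra hh
    simp [hh] at h2
  exact hne (e1.symm.trans e2)

/-- for the edge ideal `I` of a unicyclic graph with unique odd cycle `C_{2n+1}`
all of whose vertices lie in `N[V(C_{2n+1})]`, writing `s = k(n+1) + r` with `0 ≤ r ≤ n` and
`s ≥ n+1`, the exponent `k` is the least integer `γ` with `𝔪^γ · I^{(s)} ⊆ I^s`. -/
theorem unicyclic_least_annihilating_power {V : Type} [Fintype V] (𝕜 : Type) [Field 𝕜]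
    (G : SimpleGraph V) (n : ℕ) (hn : 1 ≤ n)
    (x : ZMod (2 * n + 1) → V) (hx : IsUnicyclicOddCycle G n x)
    (hN : ∀ v : V, (∃ j : ZMod (2 * n + 1), v = x j) ∨
      ∃ j : ZMod (2 * n + 1), G.Adj v (x j))
    (𝔪 : Ideal (MvPolynomial V 𝕜)) (h𝔪 : 𝔪 = Ideal.span (Set.range X))
    (s k r : ℕ) (hskr : s = k * (n + 1) + r) (hr : r ≤ n) (hs : n + 1 ≤ s) :
    𝔪 ^ k * symbolicPower (edgeIdeal 𝕜 G) s ≤ (edgeIdeal 𝕜 G) ^ s ∧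
    ¬ (𝔪 ^ (k - 1) * symbolicPower (edgeIdeal 𝕜 G) s ≤ (edgeIdeal 𝕜 G) ^ s) := by
  classical
  subst h𝔪
  set I := edgeIdeal 𝕜 G with hI
  set c : MvPolynomial V 𝕜 := ∏ i, X (x i) with hc
  have hk : 1 ≤ k := by
    by_contra hk0
    have : k = 0 := by omega
    subst this
    omega
  have hadj : ∀ i, G.Adj (x i) (x (i+1)) := fun i => (hx.adj_iff _ _).2 (Or.inl rfl)
  have hcI : c ∈ I ^ n := by
    obtain ⟨q, hq, h⟩ := cycle_factor 𝕜 G n x hadj 0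
    rw [hc, h]
    exact Ideal.mul_mem_left _ _ hq
  have hXc : ∀ v, X v * c ∈ I ^ (n+1) := by
    intro v
    obtain ⟨j, hj⟩ : ∃ j, G.Adj v (x j) := by
      rcases hN v with ⟨j, rfl⟩ | h
      · exact ⟨j+1, hadj j⟩
      · exact h
    obtain ⟨q, hq, h⟩ := cycle_factor 𝕜 G n x hadj j
    rw [hc, h, ← mul_assoc, mul_comm, pow_succ]
    exact Ideal.mul_mem_mul hq (edge_mem 𝕜 G hj)
  set 𝔫 : Ideal (MvPolynomial V 𝕜) := Ideal.span (Set.range X) with h𝔫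
  have hnc : 𝔫 * Ideal.span {c} ≤ I ^ (n+1) := by
    rw [h𝔫, Ideal.span_mul_span', Ideal.span_le]
    rintro _ ⟨_, ⟨v, rfl⟩, _, rfl, rfl⟩
    exact hXc v
  have hcle : Ideal.span {c} ≤ I ^ n := (Ideal.span_singleton_le_iff_mem _).2 hcI
  constructor
  · have main : ∀ t e : ℕ, s ≤ t * (n+1) + e → 𝔫 ^ k * (Ideal.span {c} ^ t * I ^ e) ≤ I ^ s := by
      intro t e hs'
      rcases le_or_gt t k with h | h
      · calc 𝔫 ^ k * (Ideal.span {c} ^ t * I ^ e) ≤ 𝔫 ^ t * (Ideal.span {c} ^ t * I ^ e) :=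
              Ideal.mul_mono_left (Ideal.pow_le_pow_right h)
          _ = (𝔫 * Ideal.span {c}) ^ t * I ^ e := by rw [mul_pow, mul_assoc]
          _ ≤ (I ^ (n+1)) ^ t * I ^ e := Ideal.mul_mono_left (Ideal.pow_right_mono hnc t)
          _ = I ^ (t * (n+1) + e) := by rw [← pow_mul, ← pow_add, mul_comm t]
          _ ≤ I ^ s := Ideal.pow_le_pow_right hs'
      · obtain ⟨d, rfl⟩ := Nat.exists_eq_add_of_lt h
        calc 𝔫 ^ k * (Ideal.span {c} ^ (k+d+1) * I ^ e)
            = ((𝔫 * Ideal.span {c}) ^ k * Ideal.span {c}) * (Ideal.span {c} ^ d * I ^ e) := by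
              rw [mul_pow]; ring
          _ ≤ (𝔫 * Ideal.span {c}) ^ k * Ideal.span {c} := Ideal.mul_le_left
          _ ≤ (I ^ (n+1)) ^ k * I ^ n := Ideal.mul_mono (Ideal.pow_right_mono hnc k) hcle
          _ = I ^ (k * (n+1) + n) := by rw [← pow_mul, ← pow_add, mul_comm k]
          _ ≤ I ^ s := Ideal.pow_le_pow_right (by omega)
    rw [Ideal.mul_le]
    intro g hg f hf
    rw [f.as_sum, Finset.mul_sum]
    refine Ideal.sum_mem _ fun m hm => ?_
    obtain ⟨t, e, q, hq, hs', hmon⟩ := mono_mem 𝕜 G n x hx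
      (leaf_unique G n hn x hx hN) s m (fun C _ hC => symb_cov G s f hf m hm C hC)
    have h1 : g * monomial m (coeff m f) = C (coeff m f) * (g * (c ^ t * q)) := by
      rw [hc, ← hmon, mul_left_comm, C_mul_monomial, mul_one]
    rw [h1]
    refine Ideal.mul_mem_left _ _ (main t e hs' ?_)
    exact Ideal.mul_mem_mul hg (Ideal.mul_mem_mul
      (Ideal.pow_mem_pow (Ideal.mem_span_singleton_self c) t) hq)
  · intro hle
    haveI : Nonempty V := ⟨x 0⟩
    have hsym : c ^ k * (X (x 0) * X (x (0+1))) ^ r ∈ symbolicPower I s := by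
      rw [symbolicPower, Submodule.mem_sInf]
      rintro _ ⟨p, hp, hass, rfl⟩
      rw [localizationComap, Ideal.mem_comap,
        IsLocalization.algebraMap_mem_map_algebraMap_iff p.primeCompl]
      obtain ⟨v, hv⟩ := exists_var_not_mem 𝕜 G p hass
      refine ⟨X v ^ k, fun h => hv (hp.mem_of_pow_mem _ h), ?_⟩
      rw [← mul_assoc, ← mul_pow, hskr, pow_add, mul_comm k, pow_mul]
      exact Ideal.mul_mem_mul (Ideal.pow_mem_pow (hXc v) k)
        (Ideal.pow_mem_pow (edge_mem 𝕜 G (hadj 0)) r)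
    have h1 := hle (Ideal.mul_mem_mul
      (Ideal.pow_mem_pow (Ideal.subset_span ⟨x 0, rfl⟩ : (X (x 0) : MvPolynomial V 𝕜) ∈ 𝔫) (k-1)) hsym)
    let ψ : MvPolynomial V 𝕜 →ₐ[𝕜] Polynomial 𝕜 := aeval (fun _ => Polynomial.X)
    have h2 : I ^ s ≤ Ideal.comap ψ (Ideal.span {(Polynomial.X : Polynomial 𝕜) ^ (2*s)}) := by
      rw [← Ideal.map_le_iff_le_comap, Ideal.map_pow, pow_mul, ← Ideal.span_singleton_pow]
      refine Ideal.pow_right_mono ?_ s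
      rw [Ideal.map_le_iff_le_comap, hI, edgeIdeal, Ideal.span_le]
      rintro _ ⟨u, v, -, rfl⟩
      simp only [SetLike.mem_coe, Ideal.mem_comap]
      rw [Ideal.mem_span_singleton]
      simp [ψ, sq]
    have h3 := h2 h1
    rw [Ideal.mem_comap, Ideal.mem_span_singleton] at h3
    have h4 : ψ (X (x 0) ^ (k-1) * (c ^ k * (X (x 0) * X (x (0+1))) ^ r)) =
        Polynomial.X ^ ((k-1) + ((2*n+1) * k + 2 * r)) := by
      simp only [ψ, hc, map_mul, map_pow, map_prod, aeval_X, Finset.prod_const, Finset.card_univ,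
        ZMod.card]
      rw [← sq, ← pow_mul, ← pow_mul, ← pow_add, ← pow_add]
    rw [h4, pow_dvd_pow_iff Polynomial.X_ne_zero Polynomial.not_isUnit_X] at h3
    obtain ⟨k', rfl⟩ : ∃ k', k = k' + 1 := ⟨k-1, by omega⟩
    rw [hskr] at h3
    simp only [Nat.add_sub_cancel] at h3
    nlinarith

end
end

section
/- Let G be a unicyclic graph whose unique cycle is the odd cycle C_{2n+1} = (x_1,…,x_{2n+1}) (n ≥ 1) such that every vertex of G lies in the closed neighborhood N[V(C_{2n+1})], let I = I(G) be its edge ideal, and let l = |E(G)| − (2n+1). Write s = k(n+1) + r with k ∈ ℤ and 0 ≤ r ≤ n, and assume s ≥ n+1. Then the Hilbert function h of the graded module I^{(s)}/I^s is given by h(2s−k+i) = C(2n+l+s−(k−i)(n+1), s−(k−i)(n+1)) for 0 ≤ i ≤ k−1, and h(d) = 0 for all other degrees d. -/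
open MvPolynomial

noncomputable section

open Classical in
/-- the other end of the edge indexed by `v` -/
def tgV {V : Type} {N : ℕ} (x : ZMod N → V) (p : V → ZMod N) (v : V) : V :=
  if v = x (p v) then x (p v + 1) else x (p v)

def IsCov {V : Type} (G : SimpleGraph V) (C : Finset V) : Prop :=
  ∀ u v, G.Adj u v → u ∈ C ∨ v ∈ C

open Classical in
/-- exponent of a product of edges with multiplicities `y` -/
def edgeSum {V : Type} [Fintype V] (t : V → V) (y : V → ℕ) (u : V) : ℕ :=
  y u + ∑ v, if t v = u then y v else 0

open Classical in
lemma edgeSum_weight {V : Type} [Fintype V] (t : V → V) (y c : V → ℕ) :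
    ∑ u, c u * edgeSum t y u = ∑ v, y v * (c v + c (t v)) := by
  simp only [edgeSum, mul_add, Finset.sum_add_distrib, Finset.mul_sum]
  rw [Finset.sum_comm (s := Finset.univ) (t := Finset.univ)]
  congr 1
  · exact Finset.sum_congr rfl fun _ _ => mul_comm _ _
  · refine Finset.sum_congr rfl fun v _ => ?_
    simp [mul_comm]

def altS (t : ℕ) : Prop := t = 0 ∨ t % 2 = 1

lemma zmod_succ_val {n : ℕ} (u : ZMod (2 * n + 1)) (hn : 1 ≤ n) :
    (u.val = 2 * n ∧ (u + 1).val = 0) ∨ (u.val < 2 * n ∧ (u + 1).val = u.val + 1) := by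
  have h := u.val_lt
  have : (1 : ZMod (2 * n + 1)).val = 1 := by
    have : Fact (1 < 2 * n + 1) := ⟨by omega⟩
    exact ZMod.val_one _
  rw [ZMod.val_add, this]
  by_cases h2 : u.val = 2 * n
  · left; refine ⟨h2, ?_⟩; rw [h2]; simp
  · right; refine ⟨by omega, Nat.mod_eq_of_lt (by omega)⟩

open Classical in
/-- the alternating cover `D_i` -/
def altCov {V : Type} [Fintype V] {n : ℕ} (x : ZMod (2 * n + 1) → V) (p : V → ZMod (2 * n + 1))
    (i : ZMod (2 * n + 1)) : Finset V :=
  Finset.univ.filter fun v => (v = x (p v) ↔ altS (p v - i).val)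

set_option linter.unusedSectionVars false
section comb
variable {V : Type} [Fintype V] {n : ℕ} {x : ZMod (2 * n + 1) → V} {p : V → ZMod (2 * n + 1)}
  {G : SimpleGraph V}

lemma tg_inj_val (hpx : ∀ j, p (x j) = j) {i j} (h : x i = x j) : i = j := by
  rw [← hpx i, h, hpx]

lemma mem_altCov (i : ZMod (2 * n + 1)) (v : V) :
    v ∈ altCov x p i ↔ (v = x (p v) ↔ altS (p v - i).val) := by
  simp [altCov]

lemma altCov_isCov (hn : 1 ≤ n) (hpx : ∀ j, p (x j) = j)
    (hG : ∀ u v, G.Adj u v → v = tgV x p u ∨ u = tgV x p v) (i : ZMod (2 * n + 1)) :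
    IsCov G (altCov x p i) := by
  have key : ∀ u, u ∈ altCov x p i ∨ tgV x p u ∈ altCov x p i := by
    intro u
    rw [mem_altCov, mem_altCov]
    unfold tgV
    by_cases h : u = x (p u)
    · rw [if_pos h]
      simp only [eq_true h, hpx, true_iff]
      have := zmod_succ_val (p u - i) hn
      rw [show p u - i + 1 = p u + 1 - i by ring] at this
      unfold altS
      omega
    · rw [if_neg h]
      simp only [eq_false h, hpx, true_iff, false_iff]
      exact (em _).symm
  intro u v huv
  rcases hG u v huv with rfl | rfl
  · exact key u
  · exact (key v).symm

open Classical in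
lemma altCov_pt (hn : 1 ≤ n) (hpx : ∀ j, p (x j) = j) (i : ZMod (2 * n + 1)) (v : V) :
    (if v ∈ altCov x p i then 1 else 0) + (if v ∈ altCov x p (i - 1) then 1 else 0) +
      (if (v ≠ x (p v) ∧ p v = i) then 1 else 0) = 1 + if v = x i then 1 else 0 := by
  have h1 := zmod_succ_val (p v - i) hn
  rw [show p v - i + 1 = p v - (i - 1) by ring] at h1
  have h2 : (p v - i).val = 0 ↔ p v = i := by
    rw [ZMod.val_eq_zero, sub_eq_zero]
  have h3 : v = x i ↔ v = x (p v) ∧ p v = i := by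
    constructor
    · rintro rfl; simp [hpx]
    · rintro ⟨h, rfl⟩; exact h
  simp only [mem_altCov, h3, ← h2, altS]
  by_cases h : v = x (p v)
  · simp only [eq_true h, true_iff, true_and, ne_eq, not_true, false_and]
    split_ifs <;> first | contradiction | omega
  · simp only [eq_false h, false_iff, false_and, ne_eq, not_false_iff, true_and]
    split_ifs <;> first | contradiction | omega

open Classical in
lemma tgV_pt (hpx : ∀ j, p (x j) = j) (i : ZMod (2 * n + 1)) (v : V) :
    (if tgV x p v = x i then 1 else 0) =
      (if v = x (i - 1) then 1 else 0) + (if (v ≠ x (p v) ∧ p v = i) then 1 else 0) := by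
  have h3 : v = x (i - 1) ↔ v = x (p v) ∧ p v + 1 = i := by
    constructor
    · rintro rfl; simp [hpx]
    · rintro ⟨h, rfl⟩; simpa using h
  have h4 : ∀ j, x j = x i ↔ j = i := fun j => ⟨tg_inj_val hpx, fun h => by rw [h]⟩
  unfold tgV
  rw [h3]
  clear h3
  by_cases h : v = x (p v)
  · rw [if_pos h]; simp only [h4, ne_eq, eq_true h, true_and, not_true, false_and, if_false, add_zero]
  · rw [if_neg h]; simp only [h4, ne_eq, eq_false h, not_false_iff, true_and, false_and, if_false, zero_add]

open Classical in
lemma sum_tgV (hpx : ∀ j, p (x j) = j) (i : ZMod (2 * n + 1)) (f : V → ℕ) :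
    (∑ v, if tgV x p v = x i then f v else 0) =
      f (x (i - 1)) + ∑ v, if (v ≠ x (p v) ∧ p v = i) then f v else 0 := by
  have : ∀ v, (if tgV x p v = x i then f v else 0) =
      (if v = x (i - 1) then f v else 0) + (if (v ≠ x (p v) ∧ p v = i) then f v else 0) := by
    intro v
    have := congrArg (fun t => t * f v) (tgV_pt hpx i v)
    simpa only [add_mul, ite_mul, one_mul, zero_mul] using this
  simp only [this, Finset.sum_add_distrib]
  simp

lemma sum_altCov (hn : 1 ≤ n) (hpx : ∀ j, p (x j) = j) (i : ZMod (2 * n + 1)) (f : V → ℕ) :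
    open Classical in
    (∑ v ∈ altCov x p i, f v) + (∑ v ∈ altCov x p (i - 1), f v) +
      (∑ v, if (v ≠ x (p v) ∧ p v = i) then f v else 0) = (∑ v, f v) + f (x i) := by
  classical
  have : ∀ v, (if v ∈ altCov x p i then f v else 0) + (if v ∈ altCov x p (i - 1) then f v else 0) +
      (if (v ≠ x (p v) ∧ p v = i) then f v else 0) = f v + if v = x i then f v else 0 := by
    intro v
    have := congrArg (fun t => t * f v) (altCov_pt hn hpx i v)
    simpa only [add_mul, ite_mul, one_mul, zero_mul] using this
  have h2 := Finset.sum_congr (s₁ := Finset.univ) rfl fun v _ => this v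
  simp only [Finset.sum_add_distrib] at h2
  simpa using h2

lemma edgeSum_cyc (hpx : ∀ j, p (x j) = j) (y : V → ℕ) (i : ZMod (2 * n + 1)) :
    open Classical in
    edgeSum (tgV x p) y (x i) = y (x i) + (y (x (i - 1)) +
      ∑ v, if (v ≠ x (p v) ∧ p v = i) then y v else 0) := by
  unfold edgeSum
  rw [sum_tgV hpx]

lemma edgeSum_leaf (hpx : ∀ j, p (x j) = j) (y : V → ℕ) {u : V} (hu : u ≠ x (p u)) :
    edgeSum (tgV x p) y u = y u := by
  classical
  unfold edgeSum
  rw [Finset.sum_eq_zero, add_zero]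
  intro v _
  rw [if_neg]
  unfold tgV
  split_ifs <;> (rintro rfl; simp [hpx] at hu)

open Classical in
/-- indicator of the cycle -/
def cycI (x : ZMod (2 * n + 1) → V) (p : V → ZMod (2 * n + 1)) (v : V) : ℕ :=
  if v = x (p v) then 1 else 0

lemma sum_cyc (hpx : ∀ j, p (x j) = j) (f : V → ℕ) :
    ∑ v, cycI x p v * f v = ∑ i, f (x i) := by
  classical
  simp only [cycI, ite_mul, one_mul, zero_mul, ← Finset.sum_filter]
  symm
  refine Finset.sum_bij (fun i _ => x i) ?_ ?_ ?_ ?_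
  · intro i _; simp [hpx]
  · intro i _ j _ h; exact tg_inj_val hpx h
  · intro b hb; simp at hb; exact ⟨p b, Finset.mem_univ _, hb.symm⟩
  · intros; rfl

/-- Key decomposition in low degree. -/
lemma key_low (hn : 1 ≤ n) (hpx : ∀ j, p (x j) = j)
    (hG : ∀ u v, G.Adj u v → v = tgV x p u ∨ u = tgV x p v) (a : V → ℕ) (s : ℕ)
    (hc : ∀ C, IsCov G C → s ≤ ∑ v ∈ C, a v) (hd : ∑ v, a v ≤ 2 * s) :
    ∃ y : V → ℕ, (∀ v, a v = (2 * s - ∑ v, a v) * cycI x p v + edgeSum (tgV x p) y v) ∧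
      ∑ v, y v + (2 * s - ∑ v, a v) * (n + 1) = s := by
  classical
  let y : V → ℕ := fun v => if v = x (p v) then ∑ u ∈ altCov x p (p v), a u - s else a v
  have h1 : ∀ v, a v = (2 * s - ∑ v, a v) * cycI x p v + edgeSum (tgV x p) y v := by
    intro v
    by_cases h : v = x (p v)
    · obtain ⟨i, rfl⟩ : ∃ i, v = x i := ⟨_, h⟩
      rw [edgeSum_cyc hpx]
      have e1 : y (x i) = ∑ u ∈ altCov x p i, a u - s := by simp [y, hpx]
      have e2 : y (x (i - 1)) = ∑ u ∈ altCov x p (i - 1), a u - s := by simp [y, hpx]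
      have e3 : (∑ v, if (v ≠ x (p v) ∧ p v = i) then y v else 0) =
          ∑ v, if (v ≠ x (p v) ∧ p v = i) then a v else 0 := by
        refine Finset.sum_congr rfl fun v _ => ?_
        by_cases h : (v ≠ x (p v) ∧ p v = i)
        · rw [if_pos h, if_pos h]; simp only [y, if_neg h.1]
        · rw [if_neg h, if_neg h]
      have e4 : cycI x p (x i) = 1 := by simp [cycI, hpx]
      have e5 := sum_altCov hn hpx i a
      have e6 := hc _ (altCov_isCov hn hpx hG i)
      have e7 := hc _ (altCov_isCov hn hpx hG (i - 1))
      rw [e1, e2, e3, e4]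
      omega
    · rw [edgeSum_leaf hpx y h]
      simp only [cycI, y, if_neg h]; simp
  refine ⟨y, h1, ?_⟩
  have h2 : ∑ v, a v = (2 * s - ∑ v, a v) * (2 * n + 1) + 2 * ∑ v, y v := by
    have e1 : ∑ v, a v = ∑ v, ((2 * s - ∑ v, a v) * cycI x p v + edgeSum (tgV x p) y v) :=
      Finset.sum_congr rfl fun v _ => h1 v
    have e2 := sum_cyc hpx (fun _ => 1)
    have e3 := edgeSum_weight (tgV x p) y (fun _ => 1)
    simp only [one_mul, ← Finset.sum_mul] at e3
    simp [ZMod.card] at e2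
    rw [Finset.sum_add_distrib, ← Finset.mul_sum, e2, e3] at e1
    linarith
  generalize ∑ v, a v = A at *
  obtain ⟨j, hj⟩ : ∃ j, 2 * s = A + j := ⟨2 * s - A, by omega⟩
  rw [show 2 * s - A = j by omega] at *
  nlinarith

lemma cyc_cov (hG : ∀ i, G.Adj (x i) (x (i + 1))) (C : Finset V) (hC : IsCov G C) :
    open Classical in
    n + 1 ≤ ∑ i, if x i ∈ C then 1 else 0 := by
  classical
  have h1 : ∑ i, (if x (i + 1) ∈ C then 1 else 0) = ∑ i, if x i ∈ C then 1 else 0 :=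
    Equiv.sum_comp (Equiv.addRight (1 : ZMod (2 * n + 1))) (fun i => if x i ∈ C then 1 else 0)
  have h2 : ∑ i : ZMod (2 * n + 1), 1 ≤
      ∑ i, ((if x i ∈ C then 1 else 0) + (if x (i + 1) ∈ C then 1 else 0)) := by
    refine Finset.sum_le_sum fun i _ => ?_
    rcases hC _ _ (hG i) with h | h <;> simp [h]
  rw [Finset.sum_add_distrib, h1] at h2
  simp only [Finset.sum_const, Finset.card_univ, ZMod.card, smul_eq_mul, mul_one] at h2
  omega

lemma key_conv (hpx : ∀ j, p (x j) = j) (hG : ∀ v, G.Adj v (tgV x p v)) (y : V → ℕ) (j : ℕ)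
    (C : Finset V) (hC : IsCov G C) :
    ∑ v, y v + j * (n + 1) ≤ ∑ v ∈ C, (j * cycI x p v + edgeSum (tgV x p) y v) := by
  classical
  have e1 := edgeSum_weight (tgV x p) y (fun v => if v ∈ C then 1 else 0)
  have e2 := sum_cyc hpx (fun v => if v ∈ C then 1 else 0)
  simp only [ite_mul, one_mul, zero_mul, mul_ite, mul_one, mul_zero] at e1 e2
  simp at e1 e2
  rw [Finset.sum_add_distrib, ← Finset.mul_sum, e1, e2]
  have hx : ∀ i, G.Adj (x i) (x (i + 1)) := fun i => by
    have := hG (x i); simpa [tgV, hpx] using this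
  have e3 := cyc_cov hx C hC
  simp at e3
  have e4 : ∑ v, y v ≤ ∑ v, y v * ((if v ∈ C then 1 else 0) + if tgV x p v ∈ C then 1 else 0) := by
    refine Finset.sum_le_sum fun v _ => ?_
    rcases hC _ _ (hG v) with h | h
    · simp only [h, if_true]; exact Nat.le_mul_of_pos_right _ (by omega)
    · simp only [h, if_true]; exact Nat.le_mul_of_pos_right _ (by omega)
  have : j * (n + 1) ≤ _ := Nat.mul_le_mul_left j e3
  omega

lemma edgeSum_inj (hpx : ∀ j, p (x j) = j) (y y' : V → ℕ)
    (h : ∀ v, edgeSum (tgV x p) y v = edgeSum (tgV x p) y' v) : y = y' := by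
  classical
  have hl : ∀ v, v ≠ x (p v) → y v = y' v := fun v hv => by
    have := h v; rwa [edgeSum_leaf hpx _ hv, edgeSum_leaf hpx _ hv] at this
  have hc : ∀ i, y (x i) + y (x (i - 1)) = y' (x i) + y' (x (i - 1)) := fun i => by
    have := h (x i)
    rw [edgeSum_cyc hpx, edgeSum_cyc hpx] at this
    have e3 : (∑ v, if (v ≠ x (p v) ∧ p v = i) then y v else 0) =
          ∑ v, if (v ≠ x (p v) ∧ p v = i) then y' v else 0 := by
        refine Finset.sum_congr rfl fun v _ => ?_
        by_cases h : (v ≠ x (p v) ∧ p v = i)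
        · rw [if_pos h, if_pos h, hl v h.1]
        · rw [if_neg h, if_neg h]
    omega
  have hk : ∀ i, ∀ k : ℕ, ((y (x (i + k)) : ℤ) - y' (x (i + k))) =
      (-1) ^ k * ((y (x i) : ℤ) - y' (x i)) := by
    intro i k
    induction k with
    | zero => simp
    | succ k ih =>
      have := hc (i + (k + 1 : ℕ))
      rw [show i + ((k + 1 : ℕ) : ZMod (2 * n + 1)) - 1 = i + k by push_cast; ring] at this
      have h3 : ((y (x (i + (k + 1 : ℕ))) : ℤ) - y' (x (i + (k + 1 : ℕ)))) =
        - ((y (x (i + k)) : ℤ) - y' (x (i + k))) := by omega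
      rw [pow_succ, h3, ih]
      ring
  funext v
  by_cases hv : v = x (p v)
  · have := hk (p v) (2 * n + 1)
    rw [ZMod.natCast_self, add_zero, ← hv, Odd.neg_one_pow ⟨n, rfl⟩] at this
    omega
  · exact hl v hv

def Feas (G : SimpleGraph V) (w : V → ℤ) : Prop :=
  (∀ v, w v = -1 ∨ w v = 0 ∨ w v = 1) ∧ ∀ u v, G.Adj u v → 0 ≤ w u + w v

lemma feas_nz {a : V → ℕ} {s : ℕ} (hc : ∀ C, IsCov G C → s ≤ ∑ v ∈ C, a v) {w : V → ℤ}
    (hw : Feas G w) (hz : ∀ v, w v ≠ 0) :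
    2 * (s : ℤ) - ∑ v, (a v : ℤ) ≤ ∑ v, (a v : ℤ) * w v := by
  classical
  have h1 := hc (Finset.univ.filter fun v => w v = 1) (by
    intro u v huv
    have h1 := hw.2 u v huv
    have := hw.1 u; have := hw.1 v; have := hz u; have := hz v
    simp; omega)
  rw [Finset.sum_filter] at h1
  have h2 : ∑ v, (a v : ℤ) * w v = 2 * ((∑ v, if w v = 1 then a v else 0 : ℕ) : ℤ) - ∑ v, (a v : ℤ) := by
    push_cast
    rw [Finset.mul_sum, ← Finset.sum_sub_distrib]
    refine Finset.sum_congr rfl fun v _ => ?_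
    rcases hw.1 v with h | h | h
    · simp [h]
    · exact absurd h (hz v)
    · simp [h]; ring
  rw [h2]
  have : (s : ℤ) ≤ ((∑ v, if w v = 1 then a v else 0 : ℕ) : ℤ) := by exact_mod_cast h1
  linarith

lemma feas_half (hn : 1 ≤ n) (hpx : ∀ j, p (x j) = j)
    (hG : ∀ u v, G.Adj u v → v = tgV x p u ∨ u = tgV x p v) (hG2 : ∀ v, G.Adj v (tgV x p v))
    {a : V → ℕ} {s : ℕ} (hc : ∀ C, IsCov G C → s ≤ ∑ v ∈ C, a v) (hd : 2 * s < ∑ v, a v)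
    {w : V → ℤ} (hw : Feas G w) :
    2 * (s : ℤ) - ∑ v, (a v : ℤ) ≤ ∑ v, (a v : ℤ) * w v := by
  classical
  by_cases h0 : ∃ i, w (x i) ≠ 0
  · obtain ⟨i, hi⟩ := h0
    obtain ⟨σ, hσ1, hσ2⟩ : ∃ σ : V → ℤ, (∀ v, σ v = 1 ∨ σ v = -1) ∧
        ∀ v, tgV x p v ≠ x i → σ v + σ (tgV x p v) = 0 := by
      refine ⟨fun v => if v = x (p v) then (-1) ^ (p v - i).val else - (-1) ^ (p v - i).val, ?_, ?_⟩
      · intro v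
        dsimp only
        rcases neg_one_pow_eq_or ℤ (p v - i).val with h | h <;> rw [h] <;> split_ifs <;> simp
      · intro v hv
        dsimp only
        unfold tgV at hv ⊢
        by_cases h : v = x (p v)
        · rw [if_pos h] at hv ⊢
          rw [if_pos h, if_pos (by rw [hpx]), hpx]
          have h1 := zmod_succ_val (p v - i) hn
          rw [show p v - i + 1 = p v + 1 - i by ring] at h1
          have h2 : (p v + 1 - i).val ≠ 0 := by
            rw [Ne, ZMod.val_eq_zero, sub_eq_zero]
            rintro h; rw [h] at hv; exact hv rfl
          have h3 : (p v + 1 - i).val = (p v - i).val + 1 := by omega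
          rw [h3, pow_succ]; ring
        · rw [if_neg h] at hv ⊢
          rw [if_neg h, if_pos (by rw [hpx]), hpx]; ring
    have hσ3 : ∀ u v, G.Adj u v → w u = 0 → w v = 0 → σ u + σ v = 0 := by
      intro u v huv hu hv
      rcases hG u v huv with rfl | rfl
      · exact hσ2 u (by intro h; rw [h] at hv; exact hi hv)
      · rw [add_comm]; exact hσ2 v (by intro h; rw [h] at hu; exact hi hu)
    have hf1 : Feas G (fun v => if w v = 0 then σ v else w v) := by
      refine ⟨fun v => ?_, fun u v huv => ?_⟩
      · have := hw.1 v; have := hσ1 v; dsimp only; split_ifs <;> omega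
      · have := hw.1 u; have := hσ1 u; have := hw.1 v; have := hσ1 v
        have := hσ3 u v huv; have := hw.2 u v huv
        dsimp only; split_ifs <;> omega
    have hf2 : Feas G (fun v => if w v = 0 then - σ v else w v) := by
      refine ⟨fun v => ?_, fun u v huv => ?_⟩
      · have := hw.1 v; have := hσ1 v; dsimp only; split_ifs <;> omega
      · have := hw.1 u; have := hσ1 u; have := hw.1 v; have := hσ1 v
        have := hσ3 u v huv; have := hw.2 u v huv
        dsimp only; split_ifs <;> omega
    have h1 := feas_nz hc hf1 (fun v => by have := hσ1 v; split_ifs <;> omega)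
    have h2 := feas_nz hc hf2 (fun v => by have := hσ1 v; split_ifs <;> omega)
    have h3 : ∑ v, (a v : ℤ) * (if w v = 0 then σ v else w v) +
        ∑ v, (a v : ℤ) * (if w v = 0 then - σ v else w v) = 2 * ∑ v, (a v : ℤ) * w v := by
      rw [← Finset.sum_add_distrib, Finset.mul_sum]
      refine Finset.sum_congr rfl fun v _ => ?_
      split_ifs with h
      · rw [h]; ring
      · ring
    linarith
  · push Not at h0
    have h1 : ∀ v, 0 ≤ w v := by
      intro v
      by_cases h : v = x (p v)
      · rw [h, h0]
      · have := hw.2 _ _ (hG2 v)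
        rw [tgV, if_neg h, h0] at this
        linarith
    have h2 : 0 ≤ ∑ v, (a v : ℤ) * w v :=
      Finset.sum_nonneg fun v _ => mul_nonneg (by positivity) (h1 v)
    have h3 : 2 * (s : ℤ) < ∑ v, (a v : ℤ) := by exact_mod_cast hd
    linarith

lemma exists_dec (hn : 1 ≤ n) (hpx : ∀ j, p (x j) = j)
    (hG : ∀ u v, G.Adj u v → v = tgV x p u ∨ u = tgV x p v) (hG2 : ∀ v, G.Adj v (tgV x p v))
    {a : V → ℕ} {s : ℕ} (hc : ∀ C, IsCov G C → s ≤ ∑ v ∈ C, a v) (hd : 2 * s < ∑ v, a v) :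
    ∃ v, 0 < a v ∧ ∀ C, IsCov G C → v ∈ C → s + 1 ≤ ∑ v ∈ C, a v := by
  classical
  by_contra H
  push Not at H
  have h3 : 2 * (s : ℤ) < ∑ v, (a v : ℤ) := by exact_mod_cast hd
  have main : ∀ N : ℕ, ∀ w : V → ℤ, Feas G w →
      ∑ v, (a v : ℤ) * w v ≤ 2 * (s : ℤ) - ∑ v, (a v : ℤ) →
      (Finset.univ.filter fun v => w v = -1).card = N → False := by
    intro N
    induction N using Nat.strong_induction_on with
    | _ N ih =>
      intro w hw hv hN
      obtain ⟨v, -, hv1⟩ : ∃ v ∈ Finset.univ, (a v : ℤ) * w v < 0 := by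
        by_contra hcon
        push Not at hcon
        have := Finset.sum_nonneg hcon
        linarith
      have hav : 0 < a v := by
        rcases Nat.eq_zero_or_pos (a v) with h | h
        · rw [h] at hv1; simp at hv1
        · exact h
      have hwv : w v = -1 := by
        rcases hw.1 v with h | h | h
        · exact h
        · rw [h] at hv1; simp at hv1
        · rw [h] at hv1; simp at hv1; omega
      obtain ⟨C, hC, hvC, hCs⟩ := H v hav
      let c : V → ℤ := fun v => if v ∈ C then 1 else -1
      have hc1 : ∀ v, c v = 1 ∨ c v = -1 := fun v => by dsimp only [c]; split_ifs <;> simp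
      have hc2 : ∀ u v, G.Adj u v → 0 ≤ c u + c v := fun u v huv => by
        rcases hC u v huv with h | h <;> dsimp only [c] <;> rw [if_pos h] <;> split_ifs <;> simp
      have hcval : ∑ v, (a v : ℤ) * c v = 2 * ((∑ v ∈ C, a v : ℕ) : ℤ) - ∑ v, (a v : ℤ) := by
        have : ∑ v ∈ C, a v = ∑ v, if v ∈ C then a v else 0 := by simp
        rw [this]
        push_cast
        rw [Finset.mul_sum, ← Finset.sum_sub_distrib]
        refine Finset.sum_congr rfl fun v _ => ?_
        dsimp only [c]
        split_ifs
        · ring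
        · ring
      have hCs' : ((∑ v ∈ C, a v : ℕ) : ℤ) ≤ s := by
        have : ∑ v ∈ C, a v ≤ s := by omega
        exact_mod_cast this
      let w1 : V → ℤ := fun v => if w v = c v then c v else 0
      let w2 : V → ℤ := fun v => if w v = - c v then 0 else c v
      have hf1 : Feas G w1 := by
        refine ⟨fun v => ?_, fun u v huv => ?_⟩
        · have := hc1 v; dsimp only [w1]; split_ifs <;> omega
        · have := hw.1 u; have := hc1 u; have := hw.1 v; have := hc1 v
          have := hc2 u v huv; have := hw.2 u v huv
          dsimp only [w1]; split_ifs <;> omega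
      have hf2 : Feas G w2 := by
        refine ⟨fun v => ?_, fun u v huv => ?_⟩
        · have := hc1 v; dsimp only [w2]; split_ifs <;> omega
        · have := hw.1 u; have := hc1 u; have := hw.1 v; have := hc1 v
          have := hc2 u v huv; have := hw.2 u v huv
          dsimp only [w2]; split_ifs <;> omega
      have hsum : ∑ v, (a v : ℤ) * w1 v + ∑ v, (a v : ℤ) * w2 v =
          ∑ v, (a v : ℤ) * w v + ∑ v, (a v : ℤ) * c v := by
        rw [← Finset.sum_add_distrib, ← Finset.sum_add_distrib]
        refine Finset.sum_congr rfl fun v _ => ?_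
        rw [← mul_add, ← mul_add]
        congr 1
        have := hw.1 v; have := hc1 v
        dsimp only [w1, w2]; split_ifs <;> omega
      have hb2 := feas_half hn hpx hG hG2 hc hd hf2
      refine ih _ ?_ w1 hf1 (by linarith) rfl
      rw [← hN]
      refine Finset.card_lt_card ?_
      rw [Finset.ssubset_iff_of_subset]
      · refine ⟨v, by simp [hwv], ?_⟩
        simp only [Finset.mem_filter, Finset.mem_univ, true_and]
        dsimp only [w1, c]
        simp [hvC, hwv]
      · intro u
        simp only [Finset.mem_filter, Finset.mem_univ, true_and]
        dsimp only [w1]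
        split_ifs with h
        · rw [h]; exact id
        · simp
  obtain ⟨v, -, hv⟩ : ∃ v ∈ Finset.univ, 0 < a v := by
    by_contra hcon
    push Not at hcon
    have : ∑ v, a v ≤ ∑ v : V, 0 := Finset.sum_le_sum hcon
    simp at this
    simp [this] at hd
  obtain ⟨C, hC, hvC, hCs⟩ := H v hv
  refine main _ (fun v => if v ∈ C then 1 else -1) ⟨?_, ?_⟩ ?_ rfl
  · intro v; dsimp only; split_ifs <;> simp
  · intro u v huv
    rcases hC u v huv with h | h <;> dsimp only <;> rw [if_pos h] <;> split_ifs <;> simp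
  · have hcval : ∑ v, (a v : ℤ) * (if v ∈ C then 1 else -1) =
        2 * ((∑ v ∈ C, a v : ℕ) : ℤ) - ∑ v, (a v : ℤ) := by
      have : ∑ v ∈ C, a v = ∑ v, if v ∈ C then a v else 0 := by simp
      rw [this]
      push_cast
      rw [Finset.mul_sum, ← Finset.sum_sub_distrib]
      refine Finset.sum_congr rfl fun v _ => ?_
      split_ifs
      · ring
      · ring
    rw [hcval]
    have hCs' : ((∑ v ∈ C, a v : ℕ) : ℤ) ≤ s := by
      have : ∑ v ∈ C, a v ≤ s := by omega
      exact_mod_cast this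
    linarith

lemma key_high (hn : 1 ≤ n) (hpx : ∀ j, p (x j) = j)
    (hG : ∀ u v, G.Adj u v → v = tgV x p u ∨ u = tgV x p v) (hG2 : ∀ v, G.Adj v (tgV x p v))
    (s : ℕ) (N : ℕ) : ∀ a : V → ℕ, (∀ C, IsCov G C → s ≤ ∑ v ∈ C, a v) →
      ∑ v, a v = 2 * s + N → ∃ y : V → ℕ, ∑ v, y v = s ∧ ∀ v, edgeSum (tgV x p) y v ≤ a v := by
  classical
  induction N with
  | zero =>
    intro a hc hd
    obtain ⟨y, h1, h2⟩ := key_low hn hpx hG a s hc (by omega)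
    rw [hd] at h1 h2
    simp at h1 h2
    exact ⟨y, h2, fun v => (h1 v).ge⟩
  | succ N ih =>
    intro a hc hd
    obtain ⟨v, hv, hvC⟩ := exists_dec hn hpx hG hG2 hc (by omega)
    have key : ∀ C : Finset V, ∑ u ∈ C, a u = ∑ u ∈ C, Function.update a v (a v - 1) u +
        if v ∈ C then 1 else 0 := by
      intro C
      have : ∀ u, a u = Function.update a v (a v - 1) u + if v = u then 1 else 0 := by
        intro u
        by_cases h : u = v
        · subst h; simp; omega
        · simp [h, Ne.symm h]
      rw [Finset.sum_congr rfl fun u _ => this u, Finset.sum_add_distrib]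
      simp
    obtain ⟨y, h1, h2⟩ := ih (Function.update a v (a v - 1)) (fun C hC => by
      have h1 := key C
      have h2 := hc C hC
      have h3 := hvC C hC
      split_ifs at h1 with h
      · have := h3 h; omega
      · omega) (by
      have := key Finset.univ
      simp only [Finset.mem_univ, if_true] at this
      omega)
    refine ⟨y, h1, fun u => (h2 u).trans ?_⟩
    by_cases h : u = v
    · subst h; simp
    · simp [h]

end comb

lemma exists_p {V : Type} [Fintype V] {G : SimpleGraph V} {n : ℕ} (hn : 1 ≤ n)
    {x : ZMod (2 * n + 1) → V} (hx : IsUnicyclicOddCycle G n x)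
    (hN : ∀ v : V, (∃ j : ZMod (2 * n + 1), v = x j) ∨
      ∃ j : ZMod (2 * n + 1), G.Adj v (x j)) :
    ∃ p : V → ZMod (2 * n + 1), (∀ j, p (x j) = j) ∧ (∀ v, G.Adj v (tgV x p v)) ∧
      ∀ u v, G.Adj u v → v = tgV x p u ∨ u = tgV x p v := by
  classical
  have hp : ∀ v, ∃ j, v = x j ∨ ((∀ i, v ≠ x i) ∧ G.Adj v (x j)) := by
    intro v
    by_cases h : ∃ j, v = x j
    · obtain ⟨j, hj⟩ := h; exact ⟨j, Or.inl hj⟩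
    · rcases hN v with h' | ⟨j, hj⟩
      · exact absurd h' h
      · push Not at h; exact ⟨j, Or.inr ⟨h, hj⟩⟩
  choose p hp using hp
  have hpx : ∀ j, p (x j) = j := by
    intro j
    rcases hp (x j) with h | h
    · exact (hx.inj h).symm
    · exact absurd rfl (h.1 j)
  have hadj : ∀ v, G.Adj v (tgV x p v) := by
    intro v
    unfold tgV
    by_cases h : v = x (p v)
    · rw [if_pos h]
      have := (hx.adj_iff (p v) (p v + 1)).2 (Or.inl rfl)
      rwa [← h] at this
    · rw [if_neg h]
      rcases hp v with h' | h'
      · exact absurd h' h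
      · exact h'.2
  refine ⟨p, hpx, hadj, ?_⟩
  let φ : V → G.edgeSet := fun v => ⟨s(v, tgV x p v), hadj v⟩
  have htr : ∀ v, ∃ j, tgV x p v = x j := by
    intro v; unfold tgV; split_ifs
    · exact ⟨_, rfl⟩
    · exact ⟨_, rfl⟩
  have hinj : Function.Injective φ := by
    intro v w hvw
    have h1 : s(v, tgV x p v) = s(w, tgV x p w) := congrArg Subtype.val hvw
    rw [Sym2.eq_iff] at h1
    rcases h1 with h1 | ⟨h1, h2⟩
    · exact h1.1
    · exfalso
      obtain ⟨i, hi⟩ := htr w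
      rw [hi] at h1
      subst h1
      simp only [tgV, hpx, if_true] at h2
      rw [← h2] at hi
      simp only [tgV, hpx, if_true] at hi
      have h3 := hx.inj hi
      have h4 : ((2 : ℕ) : ZMod (2 * n + 1)) = 0 := by
        have : i + 1 + 1 - i = 0 := by rw [h3]; ring
        push_cast
        rw [← this]; ring
      rw [ZMod.natCast_eq_zero_iff] at h4
      have := Nat.le_of_dvd (by norm_num) h4
      omega
  have hcard : Fintype.card V = Fintype.card G.edgeSet := by
    rw [← hx.edge_count, ← Nat.card_eq_fintype_card]; rfl
  have hbij := (Fintype.bijective_iff_injective_and_card φ).2 ⟨hinj, hcard⟩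
  intro u v huv
  obtain ⟨w, hw⟩ := hbij.2 ⟨s(u, v), huv⟩
  have h1 : s(w, tgV x p w) = s(u, v) := congrArg Subtype.val hw
  rw [Sym2.eq_iff] at h1
  rcases h1 with ⟨rfl, h⟩ | ⟨rfl, h⟩
  · exact Or.inl h.symm
  · exact Or.inr h.symm

section ideals
variable {V : Type} [Fintype V] {𝕜 : Type} [Field 𝕜] {G : SimpleGraph V}

lemma supp_mul_mon (g : MvPolynomial V 𝕜) (A : V →₀ ℕ) (Q : (V →₀ ℕ) → Prop) :
    (∀ m ∈ (g * monomial A 1).support, Q m) ↔ ∀ m ∈ g.support, Q (m + A) := by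
  classical
  constructor
  · intro h m hm
    apply h
    rw [mem_support_iff, coeff_mul_monomial, mul_one]
    exact mem_support_iff.1 hm
  · intro h m hm
    rw [mem_support_iff, coeff_mul_monomial'] at hm
    split_ifs at hm with hA
    · rw [mul_one] at hm
      have := h _ (mem_support_iff.2 hm)
      rwa [tsub_add_cancel_of_le hA] at this
    · exact absurd rfl hm

lemma edgeIdeal_eq : edgeIdeal 𝕜 G = Ideal.span ((fun m => monomial m (1 : 𝕜)) ''
    {m | ∃ u v, G.Adj u v ∧ m = Finsupp.single u 1 + Finsupp.single v 1}) := by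
  unfold edgeIdeal
  congr 1
  ext q
  simp only [Set.mem_ofPred_eq, Set.mem_image]
  constructor
  · rintro ⟨u, v, h, rfl⟩
    exact ⟨_, ⟨u, v, h, rfl⟩, by simp [X, monomial_mul]⟩
  · rintro ⟨_, ⟨u, v, h, rfl⟩, rfl⟩
    exact ⟨u, v, h, by simp [X, monomial_mul]⟩

lemma mem_edgeIdeal (q : MvPolynomial V 𝕜) :
    q ∈ edgeIdeal 𝕜 G ↔ ∀ m ∈ q.support, ∃ u v, G.Adj u v ∧ m u ≠ 0 ∧ m v ≠ 0 := by
  classical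
  rw [edgeIdeal_eq, mem_ideal_span_monomial_image]
  refine forall₂_congr fun m _ => ?_
  constructor
  · rintro ⟨_, ⟨u, v, h, rfl⟩, hle⟩
    refine ⟨u, v, h, ?_, ?_⟩
    · have := hle u; simp [Finsupp.single_apply] at this; omega
    · have := hle v; simp [Finsupp.single_apply] at this; omega
  · rintro ⟨u, v, h, hu, hv⟩
    refine ⟨_, ⟨u, v, h, rfl⟩, fun w => ?_⟩
    have := h.ne
    simp only [Finsupp.add_apply, Finsupp.single_apply]
    split_ifs with h1 h2 h2
    · exact absurd (h1.trans h2.symm) this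
    · subst h1; omega
    · subst h2; omega
    · omega

/-- finsupp version of `edgeSum` -/
def edgeSumF (t : V → V) (y : V → ℕ) : V →₀ ℕ := Finsupp.equivFunOnFinite.symm (edgeSum t y)

lemma edgeSum_add_single (t : V → V) (y : V → ℕ) (w : V) :
    open Classical in
    edgeSumF t (y + Pi.single w 1) =
      edgeSumF t y + (Finsupp.single w 1 + Finsupp.single (t w) 1) := by
  classical
  ext u
  simp only [edgeSumF, Finsupp.equivFunOnFinite_symm_apply_apply, Finsupp.add_apply, edgeSum,
    Pi.add_apply, Finsupp.single_apply, Pi.single_apply]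
  have : ∀ v, (if t v = u then y v + (if v = w then 1 else 0) else 0) =
      (if t v = u then y v else 0) + (if v = w then (if t v = u then 1 else 0) else 0) := by
    intro v; split_ifs <;> simp
  simp only [this, Finset.sum_add_distrib, Finset.sum_ite_eq', Finset.mem_univ, if_true]
  by_cases h : u = w
  · subst h; simp; ring
  · simp [h, Ne.symm h]; ring

lemma edgeIdeal_pow (t : V → V) (hG2 : ∀ v, G.Adj v (t v))
    (hG : ∀ u v, G.Adj u v → v = t u ∨ u = t v) (s : ℕ) :
    edgeIdeal 𝕜 G ^ s = Ideal.span ((fun m => monomial m (1 : 𝕜)) ''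
      {m | ∃ y : V → ℕ, ∑ v, y v = s ∧ m = edgeSumF t y}) := by
  classical
  induction s with
  | zero =>
    rw [pow_zero, Ideal.one_eq_top, eq_comm, Ideal.eq_top_iff_one]
    refine Ideal.subset_span ⟨0, ⟨0, by simp, ?_⟩, by simp⟩
    ext u; simp [edgeSumF, edgeSum]
  | succ s ih =>
    rw [pow_succ, ih, edgeIdeal_eq, Ideal.span_mul_span']
    congr 1
    ext q
    simp only [Set.mem_mul, Set.mem_image, Set.mem_ofPred_eq]
    constructor
    · rintro ⟨_, ⟨_, ⟨y, hy, rfl⟩, rfl⟩, _, ⟨_, ⟨u, v, huv, rfl⟩, rfl⟩, rfl⟩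
      rcases hG u v huv with rfl | rfl
      · refine ⟨_, ⟨y + Pi.single u 1, ?_, rfl⟩, ?_⟩
        · simp [Finset.sum_add_distrib, hy]
        · rw [edgeSum_add_single]; simp [monomial_mul]
      · refine ⟨_, ⟨y + Pi.single v 1, ?_, rfl⟩, ?_⟩
        · simp [Finset.sum_add_distrib, hy]
        · rw [edgeSum_add_single, add_comm (Finsupp.single v 1)]; simp [monomial_mul]
    · rintro ⟨_, ⟨y, hy, rfl⟩, rfl⟩
      obtain ⟨w, -, hw⟩ : ∃ w ∈ Finset.univ, y w ≠ 0 := by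
        apply Finset.exists_ne_zero_of_sum_ne_zero
        omega
      obtain ⟨y', rfl⟩ : ∃ y' : V → ℕ, y = y' + Pi.single w 1 := by
        refine ⟨Function.update y w (y w - 1), ?_⟩
        ext u
        by_cases h : u = w
        · subst h; rw [Pi.add_apply, Function.update_self, Pi.single_eq_same]; omega
        · rw [Pi.add_apply, Function.update_of_ne h, Pi.single_eq_of_ne h, add_zero]
      refine ⟨_, ⟨_, ⟨y', ?_, rfl⟩, rfl⟩, _, ⟨_, ⟨w, t w, hG2 w, rfl⟩, rfl⟩, ?_⟩
      · simp [Finset.sum_add_distrib] at hy; omega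
      · rw [edgeSum_add_single]; simp [monomial_mul]

lemma mem_edgeIdeal_pow (t : V → V) (hG2 : ∀ v, G.Adj v (t v))
    (hG : ∀ u v, G.Adj u v → v = t u ∨ u = t v) (s : ℕ) (q : MvPolynomial V 𝕜) :
    q ∈ edgeIdeal 𝕜 G ^ s ↔ ∀ m ∈ q.support, ∃ y : V → ℕ, ∑ v, y v = s ∧
      ∀ v, edgeSum t y v ≤ m v := by
  rw [edgeIdeal_pow t hG2 hG, mem_ideal_span_monomial_image]
  refine forall₂_congr fun m _ => ?_
  constructor
  · rintro ⟨_, ⟨y, hy, rfl⟩, h⟩; exact ⟨y, hy, h⟩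
  · rintro ⟨y, hy, h⟩; exact ⟨_, ⟨y, hy, rfl⟩, h⟩

lemma mem_locComap {R : Type} [CommRing R] (P : Ideal R) (hP : P.IsPrime) (J : Ideal R) (q : R) :
    q ∈ localizationComap P hP J ↔ ∃ t, t ∉ P ∧ t * q ∈ J := by
  unfold localizationComap
  rw [Ideal.mem_comap, IsLocalization.algebraMap_mem_map_algebraMap_iff P.primeCompl]
  rfl

lemma exists_min_cov (C : Finset V) (hC : IsCov G C) :
    ∃ C', C' ⊆ C ∧ IsCov G C' ∧ ∀ v ∈ C', ∃ u, u ∉ C' ∧ G.Adj v u := by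
  classical
  induction C using Finset.strongInduction with
  | H C ih =>
    by_cases h : ∀ v ∈ C, ∃ u, u ∉ C ∧ G.Adj v u
    · exact ⟨C, subset_rfl, hC, h⟩
    · push Not at h
      obtain ⟨v, hv, h⟩ := h
      obtain ⟨C', h1, h2, h3⟩ := ih (C.erase v) (Finset.erase_ssubset hv) (by
        intro a b hab
        simp only [Finset.mem_erase]
        by_cases ha : a = v
        · subst ha
          right
          refine ⟨hab.ne', ?_⟩
          by_contra hb
          exact h b hb hab
        · by_cases hb : b = v
          · subst hb
            left
            refine ⟨hab.ne, ?_⟩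
            by_contra ha
            exact h a ha hab.symm
          · have := hC a b hab
            tauto)
      exact ⟨C', h1.trans (Finset.erase_subset _ _), h2, h3⟩

lemma weight_cancel (C : Finset V) (s : ℕ) (g q : MvPolynomial V 𝕜)
    (hg : ∃ m ∈ g.support, ∀ v ∈ C, m v = 0)
    (h : ∀ m ∈ (g * q).support, s ≤ ∑ v ∈ C, m v) :
    ∀ m ∈ q.support, s ≤ ∑ v ∈ C, m v := by
  classical
  let w : V → ℕ := fun v => if v ∈ C then 1 else 0
  have hw : ∀ m : V →₀ ℕ, Finsupp.weight w m = ∑ v ∈ C, m v := by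
    intro m
    rw [Finsupp.weight_apply, Finsupp.sum_fintype _ _ (by simp)]
    simp [w]
  intro m hm
  have h1 := MvPowerSeries.weightedOrder_mul w (g : MvPowerSeries V 𝕜) (q : MvPowerSeries V 𝕜)
  have h2 : MvPowerSeries.weightedOrder w (g : MvPowerSeries V 𝕜) = 0 := by
    obtain ⟨m0, hm0, hz⟩ := hg
    have := MvPowerSeries.weightedOrder_le w (f := (g : MvPowerSeries V 𝕜)) (d := m0)
      (by rw [coeff_coe]; exact mem_support_iff.1 hm0)
    rw [hw, Finset.sum_eq_zero hz] at this
    simpa using this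
  have h3 : (s : ℕ∞) ≤ MvPowerSeries.weightedOrder w ((g : MvPowerSeries V 𝕜) * (q : MvPowerSeries V 𝕜)) := by
    apply MvPowerSeries.nat_le_weightedOrder
    intro d hd
    rw [← coe_mul, coeff_coe]
    by_contra hne
    have := h d (mem_support_iff.2 hne)
    rw [hw] at hd
    omega
  have h4 := MvPowerSeries.weightedOrder_le w (f := (q : MvPowerSeries V 𝕜)) (d := m)
      (by rw [coeff_coe]; exact mem_support_iff.1 hm)
  rw [h1, h2, zero_add] at h3
  have h5 := h3.trans h4
  rw [hw] at h5
  exact_mod_cast h5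

lemma cov_assoc (C : Finset V) (hC : IsCov G C) (hm : ∀ v ∈ C, ∃ u, u ∉ C ∧ G.Adj v u) :
    ∃ (P : Ideal (MvPolynomial V 𝕜)) (_ : P.IsPrime),
      P ∈ associatedPrimes (MvPolynomial V 𝕜) (MvPolynomial V 𝕜 ⧸ edgeIdeal 𝕜 G) ∧
      ∀ q, q ∉ P → ∃ m ∈ q.support, ∀ v ∈ C, m v = 0 := by
  classical
  let P : Ideal (MvPolynomial V 𝕜) := Ideal.span (X '' (C : Set V))
  have hP : P.IsPrime := by
    have hmem : ∀ q, q ∈ P ↔ ∀ m ∈ q.support, 1 ≤ ∑ v ∈ C, m v := by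
      intro q
      rw [mem_ideal_span_X_image]
      refine forall₂_congr fun m _ => ?_
      rw [Nat.one_le_iff_ne_zero, Ne, Finset.sum_eq_zero_iff]
      push Not
      rfl
    refine ⟨?_, ?_⟩
    · rw [Ne, Ideal.eq_top_iff_one, hmem]
      intro h
      have := h 0 (by simp)
      simp at this
    · intro f g hfg
      by_contra hcon
      push Not at hcon
      obtain ⟨h1, h2⟩ := hcon
      refine h2 ((hmem g).2 (weight_cancel C 1 f g ?_ ((hmem _).1 hfg)))
      rw [mem_ideal_span_X_image] at h1
      push Not at h1
      simpa using h1
  refine ⟨P, hP, ?_, ?_⟩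
  · rw [AssociatedPrimes.mem_iff, isAssociatedPrime_iff]
    let A : V →₀ ℕ := Finsupp.equivFunOnFinite.symm fun v => if v ∈ C then 0 else 1
    refine ⟨hP, Ideal.Quotient.mk _ (monomial A 1), ?_⟩
    ext g
    rw [Submodule.mem_colon_singleton, Submodule.mem_bot, ← Ideal.Quotient.mk_eq_mk,
      ← Submodule.Quotient.mk_smul, smul_eq_mul]
    erw [Ideal.Quotient.eq_zero_iff_mem]
    rw [mem_edgeIdeal, supp_mul_mon, mem_ideal_span_X_image]
    refine forall₂_congr fun m _ => ?_
    simp only [Finsupp.add_apply, A, Finsupp.equivFunOnFinite_symm_apply_apply]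
    constructor
    · rintro ⟨v, hv, hmv⟩
      obtain ⟨u, hu, huv⟩ := hm v hv
      exact ⟨v, u, huv, by omega, by simp [hu]⟩
    · rintro ⟨u, v, huv, hu, hv⟩
      rcases hC u v huv with h | h
      · exact ⟨u, h, by simpa [h] using hu⟩
      · exact ⟨v, h, by simpa [h] using hv⟩
  · intro q hq
    rw [mem_ideal_span_X_image] at hq
    push Not at hq
    simpa using hq

lemma assoc_cov (P : Ideal (MvPolynomial V 𝕜)) 
    (hP : P ∈ associatedPrimes (MvPolynomial V 𝕜) (MvPolynomial V 𝕜 ⧸ edgeIdeal 𝕜 G)) :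
    (∀ u v, G.Adj u v → (X u : MvPolynomial V 𝕜) ∈ P ∨ (X v : MvPolynomial V 𝕜) ∈ P) ∧
    ∀ v, (X v : MvPolynomial V 𝕜) ∈ P → ∃ u, G.Adj v u ∧ (X u : MvPolynomial V 𝕜) ∉ P := by
  classical
  rw [AssociatedPrimes.mem_iff, isAssociatedPrime_iff] at hP
  obtain ⟨hprime, g', hg'⟩ := hP
  obtain ⟨g, rfl⟩ := Ideal.Quotient.mk_surjective g'
  have hmem : ∀ f, f ∈ P ↔ f * g ∈ edgeIdeal 𝕜 G := by
    intro f
    rw [hg', Submodule.mem_colon_singleton, Submodule.mem_bot, ← Ideal.Quotient.mk_eq_mk,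
      ← Submodule.Quotient.mk_smul, smul_eq_mul]
    exact Ideal.Quotient.eq_zero_iff_mem
  have hX : ∀ v, (X v : MvPolynomial V 𝕜) ∈ P ↔
      ∀ m ∈ g.support, ∃ a b, G.Adj a b ∧ (m + Finsupp.single v 1 : V →₀ ℕ) a ≠ 0 ∧
        (m + Finsupp.single v 1 : V →₀ ℕ) b ≠ 0 := by
    intro v
    rw [hmem, mul_comm, mem_edgeIdeal, X, supp_mul_mon]
  constructor
  · intro u v huv
    apply hprime.mem_or_mem
    rw [hmem]
    apply Ideal.mul_mem_right
    exact Ideal.subset_span ⟨u, v, huv, rfl⟩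
  · intro v hv
    have hg : g ∉ edgeIdeal 𝕜 G := by
      intro h
      apply hprime.ne_top
      rw [Ideal.eq_top_iff_one, hmem, one_mul]
      exact h
    rw [mem_edgeIdeal] at hg
    push Not at hg
    obtain ⟨m, hm, hmI⟩ := hg
    have key : ∃ u, G.Adj v u ∧ m u ≠ 0 := by
      obtain ⟨a, b, hab, ha, hb⟩ := (hX v).1 hv m hm
      simp only [Finsupp.add_apply, Finsupp.single_apply] at ha hb
      by_cases h1 : v = a
      · subst h1
        rw [if_neg hab.ne] at hb
        exact ⟨b, hab, hb⟩
      · rw [if_neg h1] at ha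
        by_cases h2 : v = b
        · subst h2; exact ⟨a, hab.symm, ha⟩
        · rw [if_neg h2] at hb
          exact absurd (hmI a b hab ha) hb
    obtain ⟨u, hvu, hu⟩ := key
    refine ⟨u, hvu, fun hcon => ?_⟩
    obtain ⟨a, b, hab, ha, hb⟩ := (hX u).1 hcon m hm
    have h0 : ∀ c, (m + Finsupp.single u 1 : V →₀ ℕ) c ≠ 0 → m c ≠ 0 := by
      intro c hc
      by_cases h : u = c
      · subst h; exact hu
      · simpa [Finsupp.single_apply, h] using hc
    exact h0 b hb (hmI a b hab (h0 a ha))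

lemma mem_symb (t : V → V) (hG2 : ∀ v, G.Adj v (t v))
    (hG : ∀ u v, G.Adj u v → v = t u ∨ u = t v) (s : ℕ) (q : MvPolynomial V 𝕜) :
    q ∈ symbolicPower (edgeIdeal 𝕜 G) s ↔
      ∀ m ∈ q.support, ∀ C, IsCov G C → s ≤ ∑ v ∈ C, m v := by
  classical
  unfold symbolicPower
  rw [Submodule.mem_sInf]
  constructor
  · intro h m hm C hC
    obtain ⟨C', h1, h2, h3⟩ := exists_min_cov C hC
    refine le_trans ?_ (Finset.sum_le_sum_of_subset h1)
    obtain ⟨P, hP, hPa, hPm⟩ := cov_assoc (𝕜 := 𝕜) C' h2 h3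
    have := h _ ⟨P, hP, hPa, rfl⟩
    rw [mem_locComap] at this
    obtain ⟨g, hg, hgq⟩ := this
    refine weight_cancel C' s g q (hPm g hg) ?_ m hm
    intro m hm
    rw [mem_edgeIdeal_pow t hG2 hG] at hgq
    obtain ⟨y, hy, hle⟩ := hgq m hm
    rw [← hy]
    refine le_trans ?_ (Finset.sum_le_sum fun v _ => hle v)
    have e1 := edgeSum_weight t y (fun v => if v ∈ C' then 1 else 0)
    simp only [ite_mul, one_mul, zero_mul] at e1
    simp only [Finset.sum_ite_mem, Finset.univ_inter] at e1
    rw [e1]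
    refine Finset.sum_le_sum fun v _ => ?_
    rcases h2 _ _ (hG2 v) with h | h
    · simp only [h, if_true]; exact Nat.le_mul_of_pos_right _ (by omega)
    · simp only [h, if_true]; exact Nat.le_mul_of_pos_right _ (by omega)
  · rintro h J ⟨P, hP, hPa, rfl⟩
    rw [q.as_sum]
    refine Ideal.sum_mem _ fun m hm => ?_
    rw [mem_locComap]
    obtain ⟨h1, h2⟩ := assoc_cov P hPa
    have h2' : ∀ v, ∃ u, (X v : MvPolynomial V 𝕜) ∈ P → G.Adj v u ∧ (X u : MvPolynomial V 𝕜) ∉ P := by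
      intro v
      by_cases hv : (X v : MvPolynomial V 𝕜) ∈ P
      · obtain ⟨u, hu⟩ := h2 v hv; exact ⟨u, fun _ => hu⟩
      · exact ⟨v, fun h => absurd h hv⟩
    choose f hf using h2'
    let D : Finset V := Finset.univ.filter fun v => (X v : MvPolynomial V 𝕜) ∈ P
    have hCmem : ∀ v, v ∈ D ↔ (X v : MvPolynomial V 𝕜) ∈ P := fun v => by simp [D]
    have hC : IsCov G D := fun u v huv => by rw [hCmem, hCmem]; exact h1 u v huv
    have hs := h m hm D hC
    refine ⟨∏ v ∈ D, X (f v) ^ m v, ?_, ?_⟩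
    · intro hcon
      rw [hP.prod_mem_iff] at hcon
      obtain ⟨v, hv, hv2⟩ := hcon
      exact (hf v ((hCmem v).1 hv)).2 (hP.mem_of_pow_mem _ hv2)
    · have hmon : monomial m (coeff m q) =
          (C ((coeff m q)) * ∏ v ∈ Finset.univ \ D, X v ^ m v) * ∏ v ∈ D, (X v : MvPolynomial V 𝕜) ^ m v := by
        rw [monomial_eq, Finsupp.prod_fintype _ _ (by simp), mul_assoc,
          Finset.prod_sdiff (Finset.subset_univ D)]
      rw [hmon, mul_left_comm]
      apply Ideal.mul_mem_left
      rw [← Finset.prod_mul_distrib]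
      apply Ideal.pow_le_pow_right hs
      rw [← Finset.prod_pow_eq_pow_sum]
      refine Ideal.prod_mem_prod fun v hv => ?_
      rw [← mul_pow]
      apply Ideal.pow_mem_pow
      rw [mul_comm]
      exact Ideal.subset_span ⟨v, f v, (hf v ((hCmem v).1 hv)).1, rfl⟩
end ideals

section final
variable {V : Type} [Fintype V] {n : ℕ} {x : ZMod (2 * n + 1) → V} {p : V → ZMod (2 * n + 1)}
  {G : SimpleGraph V}

/-- exponents of degree `d` of monomials in the `s`-th symbolic power -/
def symbExp (G : SimpleGraph V) (s d : ℕ) : Set (V →₀ ℕ) :=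
  {m | (∀ C, IsCov G C → s ≤ ∑ v ∈ C, m v) ∧ ∑ v, m v = d}

lemma mem_homog (𝕜 : Type) [Field 𝕜] (d : ℕ) (q : MvPolynomial V 𝕜) :
    q ∈ homogeneousSubmodule V 𝕜 d ↔ ∀ m ∈ q.support, ∑ v, m v = d := by
  rw [mem_homogeneousSubmodule, IsHomogeneous, IsWeightedHomogeneous]
  refine forall_congr' fun m => ?_
  rw [mem_support_iff, Finsupp.weight_apply, Finsupp.sum_fintype _ _ (by simp)]
  simp

lemma total_sum (hpx : ∀ j, p (x j) = j) (j : ℕ) (y : V → ℕ) :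
    ∑ v, (j * cycI x p v + edgeSum (tgV x p) y v) = j * (2 * n + 1) + 2 * ∑ v, y v := by
  have e2 := sum_cyc hpx (fun _ => 1)
  have e3 := edgeSum_weight (tgV x p) y (fun _ => 1)
  simp only [one_mul, ← Finset.sum_mul] at e3
  simp [ZMod.card] at e2
  rw [Finset.sum_add_distrib, ← Finset.mul_sum, e2, e3]
  ring

lemma card_symbExp (hn : 1 ≤ n) (hpx : ∀ j, p (x j) = j)
    (hG : ∀ u v, G.Adj u v → v = tgV x p u ∨ u = tgV x p v) (hG2 : ∀ v, G.Adj v (tgV x p v))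
    (s d j : ℕ) (hd : d + j = 2 * s) :
    Nat.card (symbExp G s d) = if j * (n + 1) ≤ s then
      (Fintype.card V + (s - j * (n + 1)) - 1).choose (s - j * (n + 1)) else 0 := by
  classical
  have low : ∀ m ∈ symbExp G s d, ∃ y : V → ℕ,
      (∀ v, m v = j * cycI x p v + edgeSum (tgV x p) y v) ∧ ∑ v, y v + j * (n + 1) = s := by
    intro m hm
    have := key_low hn hpx hG m s hm.1 (by rw [hm.2]; omega)
    rw [hm.2, show 2 * s - d = j by omega] at this
    exact this
  split_ifs with hj
  · rw [← Finset.card_univ (α := V), ← Finset.card_finsuppAntidiag_nat_eq_choose,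
      ← Fintype.card_coe, ← Nat.card_eq_fintype_card]
    symm
    let F : (Finset.univ : Finset V).finsuppAntidiag (s - j * (n + 1)) → symbExp G s d :=
      fun y => ⟨Finsupp.equivFunOnFinite.symm fun v => j * cycI x p v + edgeSum (tgV x p) y.1 v, by
        have hy := (Finset.mem_finsuppAntidiag.1 y.2).1
        constructor
        · intro C hC
          have := key_conv hpx hG2 y.1 j C hC
          simp only [Finsupp.equivFunOnFinite_symm_apply_apply]
          refine le_trans ?_ this
          rw [hy]; omega
        · simp only [Finsupp.equivFunOnFinite_symm_apply_apply]
          rw [total_sum hpx, hy]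
          obtain ⟨t, rfl⟩ := Nat.exists_eq_add_of_le hj
          rw [Nat.add_sub_cancel_left]
          nlinarith⟩
    refine Nat.card_congr (Equiv.ofBijective F ⟨?_, ?_⟩)
    · intro y y' h
      have h1 := congrArg Subtype.val h
      apply Subtype.ext
      apply DFunLike.coe_injective
      apply edgeSum_inj hpx
      intro v
      have := DFunLike.congr_fun h1 v
      simp only [F, Finsupp.equivFunOnFinite_symm_apply_apply] at this
      omega
    · rintro ⟨m, hm⟩
      obtain ⟨y, h1, h2⟩ := low m hm
      refine ⟨⟨Finsupp.equivFunOnFinite.symm y, ?_⟩, ?_⟩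
      · rw [Finset.mem_finsuppAntidiag]
        refine ⟨?_, Finset.subset_univ _⟩
        simp only [Finsupp.equivFunOnFinite_symm_apply_apply]
        omega
      · apply Subtype.ext
        ext v
        simp only [F, Finsupp.equivFunOnFinite_symm_apply_apply]
        exact (h1 v).symm
  · have : IsEmpty (symbExp G s d) := ⟨fun m => by
      obtain ⟨y, h1, h2⟩ := low m.1 m.2
      omega⟩
    simp

lemma symb_inf (𝕜 : Type) [Field 𝕜] (t : V → V) (hG2 : ∀ v, G.Adj v (t v))
    (hG : ∀ u v, G.Adj u v → v = t u ∨ u = t v) (s d : ℕ) :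
    (Submodule.restrictScalars 𝕜 (symbolicPower (edgeIdeal 𝕜 G) s) ⊓
          homogeneousSubmodule V 𝕜 d) = restrictSupport 𝕜 (symbExp G s d) := by
  ext q
  rw [Submodule.mem_inf, Submodule.restrictScalars_mem, mem_symb t hG2 hG, mem_homog,
    mem_restrictSupport_iff]
  constructor
  · rintro ⟨h1, h2⟩ m hm
    exact ⟨h1 m hm, h2 m hm⟩
  · intro h
    exact ⟨fun m hm => (h hm).1, fun m hm => (h hm).2⟩

lemma hilb_low (𝕜 : Type) [Field 𝕜] (t : V → V) (hG2 : ∀ v, G.Adj v (t v))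
    (hG : ∀ u v, G.Adj u v → v = t u ∨ u = t v) (s d : ℕ) (hd : d < 2 * s) :
    Module.finrank 𝕜
      (↥(Submodule.restrictScalars 𝕜 (symbolicPower (edgeIdeal 𝕜 G) s) ⊓
          homogeneousSubmodule V 𝕜 d) ⧸
        Submodule.comap
          (Submodule.restrictScalars 𝕜 (symbolicPower (edgeIdeal 𝕜 G) s) ⊓
            homogeneousSubmodule V 𝕜 d).subtype
          (Submodule.restrictScalars 𝕜 ((edgeIdeal 𝕜 G) ^ s) ⊓
            homogeneousSubmodule V 𝕜 d)) = Nat.card (symbExp G s d) := by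
  have h0 : (Submodule.restrictScalars 𝕜 ((edgeIdeal 𝕜 G) ^ s) ⊓
            homogeneousSubmodule V 𝕜 d) = ⊥ := by
    rw [eq_bot_iff]
    intro q hq
    rw [Submodule.mem_inf, Submodule.restrictScalars_mem, mem_edgeIdeal_pow t hG2 hG, mem_homog] at hq
    rw [Submodule.mem_bot, ← support_eq_empty, Finset.eq_empty_iff_forall_notMem]
    intro m hm
    obtain ⟨y, hy, hle⟩ := hq.1 m hm
    have h1 := hq.2 m hm
    have e3 := edgeSum_weight t y (fun _ => 1)
    simp only [one_mul, ← Finset.sum_mul] at e3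
    have := Finset.sum_le_sum (s := Finset.univ) fun v _ => hle v
    omega
  have h1 : Submodule.comap
          (Submodule.restrictScalars 𝕜 (symbolicPower (edgeIdeal 𝕜 G) s) ⊓
            homogeneousSubmodule V 𝕜 d).subtype
          (Submodule.restrictScalars 𝕜 ((edgeIdeal 𝕜 G) ^ s) ⊓
            homogeneousSubmodule V 𝕜 d) = ⊥ := by
    rw [h0, Submodule.comap_bot, Submodule.ker_subtype]
  rw [(Submodule.quotEquivOfEqBot _ h1).finrank_eq, symb_inf 𝕜 t hG2 hG s d]
  exact Module.finrank_eq_nat_card_basis (basisRestrictSupport 𝕜 _)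

lemma hilb_high (𝕜 : Type) [Field 𝕜] (hn : 1 ≤ n) (hpx : ∀ j, p (x j) = j)
    (hG : ∀ u v, G.Adj u v → v = tgV x p u ∨ u = tgV x p v) (hG2 : ∀ v, G.Adj v (tgV x p v))
    (s d : ℕ) (hd : 2 * s ≤ d) :
    Module.finrank 𝕜
      (↥(Submodule.restrictScalars 𝕜 (symbolicPower (edgeIdeal 𝕜 G) s) ⊓
          homogeneousSubmodule V 𝕜 d) ⧸
        Submodule.comap
          (Submodule.restrictScalars 𝕜 (symbolicPower (edgeIdeal 𝕜 G) s) ⊓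
            homogeneousSubmodule V 𝕜 d).subtype
          (Submodule.restrictScalars 𝕜 ((edgeIdeal 𝕜 G) ^ s) ⊓
            homogeneousSubmodule V 𝕜 d)) = 0 := by
  have h1 : Submodule.comap
          (Submodule.restrictScalars 𝕜 (symbolicPower (edgeIdeal 𝕜 G) s) ⊓
            homogeneousSubmodule V 𝕜 d).subtype
          (Submodule.restrictScalars 𝕜 ((edgeIdeal 𝕜 G) ^ s) ⊓
            homogeneousSubmodule V 𝕜 d) = ⊤ := by
    rw [Submodule.comap_subtype_eq_top]
    intro q hq
    rw [Submodule.mem_inf, Submodule.restrictScalars_mem, mem_symb _ hG2 hG, mem_homog] at hq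
    rw [Submodule.mem_inf, Submodule.restrictScalars_mem, mem_edgeIdeal_pow _ hG2 hG, mem_homog]
    refine ⟨fun m hm => ?_, hq.2⟩
    obtain ⟨N, rfl⟩ := Nat.exists_eq_add_of_le hd
    exact key_high hn hpx hG hG2 s N m (hq.1 m hm) (hq.2 m hm)
  have := Submodule.Quotient.subsingleton_iff.2 h1
  exact Module.finrank_zero_of_subsingleton

end final

/-- the Hilbert function of `I^{(s)}/I^s` for the edge ideal `I` of a unicyclic
graph with unique odd cycle `C_{2n+1}` all of whose vertices lie in `N[V(C_{2n+1})]`, with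
`l = |E(G)| - (2n+1)` and `s = k(n+1) + r`, `0 ≤ r ≤ n`, `s ≥ n+1`:
`h(2s-k+i) = C(2n+l+s-(k-i)(n+1), s-(k-i)(n+1))` for `0 ≤ i ≤ k-1` and `h(d) = 0` otherwise.
Here `h d` is the `𝕜`-dimension of the degree-`d` component of `I^{(s)}/I^s`, i.e. of the
quotient of the degree-`d` components of `I^{(s)}` and `I^s`. -/
theorem unicyclic_hilbert_function {V : Type} [Fintype V] (𝕜 : Type) [Field 𝕜]
    (G : SimpleGraph V) (n : ℕ) (hn : 1 ≤ n)
    (x : ZMod (2 * n + 1) → V) (hx : IsUnicyclicOddCycle G n x)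
    (hN : ∀ v : V, (∃ j : ZMod (2 * n + 1), v = x j) ∨
      ∃ j : ZMod (2 * n + 1), G.Adj v (x j))
    (l : ℕ) (hl : l = G.edgeSet.ncard - (2 * n + 1))
    (s k r : ℕ) (hskr : s = k * (n + 1) + r) (hr : r ≤ n) (hs : n + 1 ≤ s)
    (h : ℕ → ℕ)
    (hh : ∀ d : ℕ, h d = Module.finrank 𝕜
      (↥(Submodule.restrictScalars 𝕜 (symbolicPower (edgeIdeal 𝕜 G) s) ⊓
          homogeneousSubmodule V 𝕜 d) ⧸
        Submodule.comap
          (Submodule.restrictScalars 𝕜 (symbolicPower (edgeIdeal 𝕜 G) s) ⊓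
            homogeneousSubmodule V 𝕜 d).subtype
          (Submodule.restrictScalars 𝕜 ((edgeIdeal 𝕜 G) ^ s) ⊓
            homogeneousSubmodule V 𝕜 d))) :
    (∀ i : ℕ, i ≤ k - 1 →
      h (2 * s - k + i) =
        Nat.choose (2 * n + l + s - (k - i) * (n + 1)) (s - (k - i) * (n + 1))) ∧
    (∀ d : ℕ, (∀ i : ℕ, i ≤ k - 1 → d ≠ 2 * s - k + i) → h d = 0) := by
  obtain ⟨p, hpx, hG2, hG⟩ := exists_p hn hx hN
  have hcard : Fintype.card V = 2 * n + 1 + l := by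
    have h1 := Fintype.card_le_of_injective x hx.inj
    rw [ZMod.card] at h1
    rw [hx.edge_count] at hl
    omega
  have hk : 1 ≤ k := by
    rcases Nat.eq_zero_or_pos k with h0 | h0
    · subst h0; omega
    · exact h0
  have hks : k ≤ s := by nlinarith
  have hlow : ∀ d j, d + j = 2 * s → 1 ≤ j → h d = if j * (n + 1) ≤ s then
      (2 * n + 1 + l + (s - j * (n + 1)) - 1).choose (s - j * (n + 1)) else 0 := by
    intro d j hd hj
    rw [hh, hilb_low 𝕜 (tgV x p) hG2 hG s d (by omega), card_symbExp hn hpx hG hG2 s d j hd, hcard]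
  constructor
  · intro i hi
    have hle : (k - i) * (n + 1) ≤ s :=
      (Nat.mul_le_mul_right (n + 1) (Nat.sub_le k i)).trans (by omega)
    rw [hlow _ (k - i) (by omega) (by omega), if_pos hle]
    congr 1
    omega
  · intro d hd
    by_cases h2 : 2 * s ≤ d
    · rw [hh]
      exact hilb_high 𝕜 hn hpx hG hG2 s d h2
    · have hj : k + 1 ≤ 2 * s - d := by
        by_contra hcon
        exact hd (k - (2 * s - d)) (by omega) (by omega)
      have : (k + 1) * (n + 1) ≤ (2 * s - d) * (n + 1) := Nat.mul_le_mul_right _ hj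
      rw [hlow d (2 * s - d) (by omega) (by omega), if_neg]
      nlinarith

end
end
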